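/- Let P(λ) = Σ_{i=0}^k λ^i A_i be an m×n matrix polynomial of grade k with m > n, and let L_t(λ) be any linearization of P(λ) arising by trimming a g-linearization in 𝕃₁(P) of full Z-rank; write L_t(λ) = D̃ L̂_t(λ) where D̃ is nonsingular and L̂_t(λ) = λ[[αA_k, X₁₂],[0, −R̃]] + [[Y₁₁, αA₀],[R̃, 0]] with α ≠ 0, X₁₂ + Y₁₁ = α[A_{k−1} … A₁] and R̃ nonsingular upper triangular; write A(λ) = λ[αA_k X₁₂] + [Y₁₁ αA₀]. If ΔL_t(λ) is any pencil of the same size as L_t(λ) with ‖ΔL_t‖_F < σ_min(R̃)σ_min(D̃)/(2k^{3/2}), then L_t(λ)+ΔL_t(λ) is a strong linearization of a matrix polynomial P(λ)+ΔP(λ) of grade k with ‖ΔP‖_F/‖P‖_F ≤ C · ‖ΔL_t‖_F/‖L_t‖_F, where C = (κ₂(D̃)/|α|)(‖L̂_t‖_F/‖P‖_F)(3 + 2k‖A‖_F/σ_min(R̃)) and κ₂(D̃) is the 2-norm condition number of D̃. Moreover, the right minimal indices of L_t+ΔL_t are those of P+ΔP shifted by k−1 and the left minimal indices of L_t+ΔL_t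 are the same as those of P+ΔP, which is the same relationship as that between the minimal indices of L_t and P. -/

import Mathlib

noncomputable section

open Polynomial Matrix

namespace GLin

variable {F : Type*} [RCLike F]

/-! ### Matrix polynomials and pencils -/

/-- The matrix polynomial `P(λ) = ∑_{i=0}^k λ^i A_i` determined by its
coefficient matrices `A_0, …, A_k` (grade `k`). -/
def matPoly {k m n : ℕ} (A : Fin (k + 1) → Matrix (Fin m) (Fin n) F) :
    Matrix (Fin m) (Fin n) F[X] :=
  Matrix.of fun r c => ∑ i : Fin (k + 1), Polynomial.C (A i r c) * Polynomial.X ^ (i : ℕ)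

/-- The matrix pencil `L(λ) = λ X + Y`. -/
def pencil {ρ γ : Type*} (Xc Yc : Matrix ρ γ F) : Matrix ρ γ F[X] :=
  Matrix.of fun i j => Polynomial.C (Xc i j) * Polynomial.X + Polynomial.C (Yc i j)

/-- `Λ_k(λ) ⊗ I_n` where `Λ_k(λ) = (λ^{k-1}, …, λ, 1)ᵀ`. -/
def Lam (F : Type*) [RCLike F] (k n : ℕ) : Matrix (Fin k × Fin n) (Fin n) F[X] :=
  Matrix.of fun p c => if p.2 = c then Polynomial.X ^ (k - 1 - (p.1 : ℕ)) else 0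

/-- `Λ_k(λ)ᵀ ⊗ I_m`. -/
def LamRow (F : Type*) [RCLike F] (k m : ℕ) : Matrix (Fin m) (Fin k × Fin m) F[X] :=
  Matrix.of fun r p => if r = p.2 then Polynomial.X ^ (k - 1 - (p.1 : ℕ)) else 0

/-- `v ⊗ P(λ)`. -/
def vkron {k m n : ℕ} (v : Fin k → F) (P : Matrix (Fin m) (Fin n) F[X]) :
    Matrix (Fin k × Fin m) (Fin n) F[X] :=
  Matrix.of fun p c => Polynomial.C (v p.1) * P p.2 c

/-- `wᵀ ⊗ P(λ)`. -/
def wkron {k m n : ℕ} (w : Fin k → F) (P : Matrix (Fin m) (Fin n) F[X]) :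
    Matrix (Fin m) (Fin k × Fin n) F[X] :=
  Matrix.of fun r q => Polynomial.C (w q.1) * P r q.2

/-- The defining identity of `𝕃₁(P)`: `L(λ)(Λ_k(λ) ⊗ I_n) = v ⊗ P(λ)`. -/
def RightAnsatz {k m n : ℕ} (P : Matrix (Fin m) (Fin n) F[X])
    (L : Matrix (Fin k × Fin m) (Fin k × Fin n) F[X]) (v : Fin k → F) : Prop :=
  L * Lam F k n = vkron v P

/-- The defining identity of `𝕃₂(P)`: `(Λ_k(λ)ᵀ ⊗ I_m) L(λ) = wᵀ ⊗ P(λ)`. -/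
def LeftAnsatz {k m n : ℕ} (P : Matrix (Fin m) (Fin n) F[X])
    (L : Matrix (Fin k × Fin m) (Fin k × Fin n) F[X]) (w : Fin k → F) : Prop :=
  LamRow F k m * L = wkron w P

/-- The vector `α e₁ ∈ F^k`. -/
def e1 {k : ℕ} (α : F) : Fin k → F := fun i => if (i : ℕ) = 0 then α else 0

/-- `M ⊗ I_m`. -/
def kronId {k m : ℕ} (M : Matrix (Fin k) (Fin k) F) :
    Matrix (Fin k × Fin m) (Fin k × Fin m) F :=
  Matrix.of fun p q => if p.2 = q.2 then M p.1 q.1 else 0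

/-! ### (strong) g-linearizations -/

/-- `diag(P(λ), I_{k-1} ⊗ I_{m,n})`. -/
def glinTarget {k m n : ℕ} (P : Matrix (Fin m) (Fin n) F[X]) :
    Matrix (Fin k × Fin m) (Fin k × Fin n) F[X] :=
  Matrix.of fun p q =>
    if p.1 = q.1 then
      (if (p.1 : ℕ) = 0 then P p.2 q.2 else if (p.2 : ℕ) = (q.2 : ℕ) then 1 else 0)
    else 0

/-- A `km × kn` pencil (or matrix polynomial) `L` is a g-linearization of the `m × n`
matrix polynomial `P` of grade `k` if `E(λ) L(λ) G(λ) = diag(P(λ), I_{k-1} ⊗ I_{m,n})`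
for unimodular `E`, `G`. -/
def IsGLin {k m n : ℕ} (P : Matrix (Fin m) (Fin n) F[X])
    (L : Matrix (Fin k × Fin m) (Fin k × Fin n) F[X]) : Prop :=
  ∃ (E : Matrix (Fin k × Fin m) (Fin k × Fin m) F[X])
    (G : Matrix (Fin k × Fin n) (Fin k × Fin n) F[X]),
      IsUnit E.det ∧ IsUnit G.det ∧ E * L * G = glinTarget P

/-- grade-`N` reversal `rev_N P(λ) = λ^N P(1/λ)`, entrywise. -/
def revMat {ρ γ : Type*} (N : ℕ) (P : Matrix ρ γ F[X]) : Matrix ρ γ F[X] :=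
  P.map fun p => Polynomial.reflect N p

/-- Strong g-linearization of the grade-`k` matrix polynomial with coefficients `A`. -/
def IsStrongGLin {k m n : ℕ} (A : Fin (k + 1) → Matrix (Fin m) (Fin n) F)
    (L : Matrix (Fin k × Fin m) (Fin k × Fin n) F[X]) : Prop :=
  IsGLin (matPoly A) L ∧ IsGLin (revMat k (matPoly A)) (revMat 1 L)

/-! ### linearizations (rectangular, of size `(m+s) × (n+s)`) -/

/-- A matrix polynomial `L` (indexed by arbitrary finite types of cardinalities
`m + s` and `n + s`) is a linearization of `P` if, after identifying the index types
with `Fin m ⊕ Fin s` and `Fin n ⊕ Fin s`, one has `E(λ) L(λ) G(λ) = diag(P(λ), I_s)`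
for unimodular `E`, `G`. -/
def IsLin {m n : ℕ} (s : ℕ) (P : Matrix (Fin m) (Fin n) F[X])
    {ρ γ : Type*} [Fintype ρ] [DecidableEq ρ] [Fintype γ] [DecidableEq γ]
    (L : Matrix ρ γ F[X]) : Prop :=
  ∃ (er : ρ ≃ (Fin m ⊕ Fin s)) (ec : γ ≃ (Fin n ⊕ Fin s))
    (E : Matrix (Fin m ⊕ Fin s) (Fin m ⊕ Fin s) F[X])
    (G : Matrix (Fin n ⊕ Fin s) (Fin n ⊕ Fin s) F[X]),
      IsUnit E.det ∧ IsUnit G.det ∧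
        E * Matrix.reindex er ec L * G = Matrix.fromBlocks P 0 0 1

/-- Strong linearization of the grade-`k` matrix polynomial with coefficients `A`. -/
def IsStrongLin {k m n : ℕ} (s : ℕ) (A : Fin (k + 1) → Matrix (Fin m) (Fin n) F)
    {ρ γ : Type*} [Fintype ρ] [DecidableEq ρ] [Fintype γ] [DecidableEq γ]
    (L : Matrix ρ γ F[X]) : Prop :=
  IsLin s (matPoly A) L ∧ IsLin s (revMat k (matPoly A)) (revMat 1 L)

/-! ### shifted sums -/

/-- Column shifted sum `X ⊞→ Y`. -/
def colShiftSum {k m n : ℕ} (Xc Yc : Matrix (Fin k × Fin m) (Fin k × Fin n) F) :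
    Matrix (Fin k × Fin m) (Fin (k + 1) × Fin n) F :=
  Matrix.of fun p q =>
    (if h : (q.1 : ℕ) < k then Xc p (⟨(q.1 : ℕ), h⟩, q.2) else 0) +
    (if h : 0 < (q.1 : ℕ) then
        Yc p (⟨(q.1 : ℕ) - 1, by have := q.1.isLt; omega⟩, q.2)
      else 0)

/-- Row shifted sum `X ⊞↓ Y`. -/
def rowShiftSum {k m n : ℕ} (Xc Yc : Matrix (Fin k × Fin m) (Fin k × Fin n) F) :
    Matrix (Fin (k + 1) × Fin m) (Fin k × Fin n) F :=
  Matrix.of fun p q =>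
    (if h : (p.1 : ℕ) < k then Xc (⟨(p.1 : ℕ), h⟩, p.2) q else 0) +
    (if h : 0 < (p.1 : ℕ) then
        Yc (⟨(p.1 : ℕ) - 1, by have := p.1.isLt; omega⟩, p.2) q
      else 0)

/-! ### the parametrization of `𝕃₁(P)` and `𝕃₂(P)` -/

/-- `X = [v ⊗ A_k ∣ -W]`. -/
def L1X {k m n : ℕ} (A : Fin (k + 1) → Matrix (Fin m) (Fin n) F) (v : Fin k → F)
    (W : Matrix (Fin k × Fin m) (Fin (k - 1) × Fin n) F) :
    Matrix (Fin k × Fin m) (Fin k × Fin n) F :=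
  Matrix.of fun p q =>
    if h : (q.1 : ℕ) = 0 then v p.1 * A (Fin.last k) p.2 q.2
    else -W p (⟨(q.1 : ℕ) - 1, by have := q.1.isLt; omega⟩, q.2)

/-- `Y = [W + v ⊗ [A_{k-1} ⋯ A_1] ∣ v ⊗ A_0]`. -/
def L1Y {k m n : ℕ} (A : Fin (k + 1) → Matrix (Fin m) (Fin n) F) (v : Fin k → F)
    (W : Matrix (Fin k × Fin m) (Fin (k - 1) × Fin n) F) :
    Matrix (Fin k × Fin m) (Fin k × Fin n) F :=
  Matrix.of fun p q =>
    if h : (q.1 : ℕ) < k - 1 then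
      W p (⟨(q.1 : ℕ), h⟩, q.2) + v p.1 * A (⟨k - 1 - (q.1 : ℕ), by omega⟩) p.2 q.2
    else v p.1 * A 0 p.2 q.2

/-- `X = [wᵀ ⊗ A_k ; -Ŵ]`. -/
def L2X {k m n : ℕ} (A : Fin (k + 1) → Matrix (Fin m) (Fin n) F) (w : Fin k → F)
    (W : Matrix (Fin (k - 1) × Fin m) (Fin k × Fin n) F) :
    Matrix (Fin k × Fin m) (Fin k × Fin n) F :=
  Matrix.of fun p q =>
    if h : (p.1 : ℕ) = 0 then w q.1 * A (Fin.last k) p.2 q.2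
    else -W (⟨(p.1 : ℕ) - 1, by have := p.1.isLt; omega⟩, p.2) q

/-- `Y = [Ŵ + wᵀ ⊗ [A_{k-1}ᵀ ⋯ A_1ᵀ]ᵀ ; wᵀ ⊗ A_0]`. -/
def L2Y {k m n : ℕ} (A : Fin (k + 1) → Matrix (Fin m) (Fin n) F) (w : Fin k → F)
    (W : Matrix (Fin (k - 1) × Fin m) (Fin k × Fin n) F) :
    Matrix (Fin k × Fin m) (Fin k × Fin n) F :=
  Matrix.of fun p q =>
    if h : (p.1 : ℕ) < k - 1 then
      W (⟨(p.1 : ℕ), h⟩, p.2) q + w q.1 * A (⟨k - 1 - (p.1 : ℕ), by omega⟩) p.2 q.2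
    else w q.1 * A 0 p.2 q.2

/-! ### block structure and `Z`-matrices -/

/-- Assemble a `km × kn` matrix from blocks with row split `m + (k-1)m` and
column split `n + (k-1)n`. -/
def blk {k m n : ℕ} (TL : Matrix (Fin m) (Fin n) F)
    (TR : Matrix (Fin m) (Fin (k - 1) × Fin n) F)
    (BL : Matrix (Fin (k - 1) × Fin m) (Fin n) F)
    (BR : Matrix (Fin (k - 1) × Fin m) (Fin (k - 1) × Fin n) F) :
    Matrix (Fin k × Fin m) (Fin k × Fin n) F :=
  Matrix.of fun p q =>
    if hp : (p.1 : ℕ) = 0 then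
      if hq : (q.1 : ℕ) = 0 then TL p.2 q.2
      else TR p.2 (⟨(q.1 : ℕ) - 1, by have := q.1.isLt; omega⟩, q.2)
    else
      if hq : (q.1 : ℕ) = 0 then
        BL (⟨(p.1 : ℕ) - 1, by have := p.1.isLt; omega⟩, p.2) q.2
      else
        BR (⟨(p.1 : ℕ) - 1, by have := p.1.isLt; omega⟩, p.2)
          (⟨(q.1 : ℕ) - 1, by have := q.1.isLt; omega⟩, q.2)

/-- Assemble `[[Y₁₁, T],[Z, 0]]`, row split `m + (k-1)m`, column split `(k-1)n + n`. -/
def blkY1 {k m n : ℕ} (Y11 : Matrix (Fin m) (Fin (k - 1) × Fin n) F)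
    (T : Matrix (Fin m) (Fin n) F)
    (Z : Matrix (Fin (k - 1) × Fin m) (Fin (k - 1) × Fin n) F) :
    Matrix (Fin k × Fin m) (Fin k × Fin n) F :=
  Matrix.of fun p q =>
    if hp : (p.1 : ℕ) = 0 then
      if hq : (q.1 : ℕ) < k - 1 then Y11 p.2 (⟨(q.1 : ℕ), hq⟩, q.2) else T p.2 q.2
    else
      if hq : (q.1 : ℕ) < k - 1 then
        Z (⟨(p.1 : ℕ) - 1, by have := p.1.isLt; omega⟩, p.2) (⟨(q.1 : ℕ), hq⟩, q.2)
      else 0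

/-- Assemble `[[Y₁₁, Z],[T, 0]]`, row split `(k-1)m + m`, column split `n + (k-1)n`. -/
def blkY2 {k m n : ℕ} (Y11 : Matrix (Fin (k - 1) × Fin m) (Fin n) F)
    (Z : Matrix (Fin (k - 1) × Fin m) (Fin (k - 1) × Fin n) F)
    (T : Matrix (Fin m) (Fin n) F) :
    Matrix (Fin k × Fin m) (Fin k × Fin n) F :=
  Matrix.of fun p q =>
    if hp : (p.1 : ℕ) < k - 1 then
      if hq : (q.1 : ℕ) = 0 then Y11 (⟨(p.1 : ℕ), hp⟩, p.2) q.2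
      else Z (⟨(p.1 : ℕ), hp⟩, p.2) (⟨(q.1 : ℕ) - 1, by have := q.1.isLt; omega⟩, q.2)
    else
      if hq : (q.1 : ℕ) = 0 then T p.2 q.2 else 0

/-- The `Z`-matrix of `L = λX + Y ∈ 𝕃₁(P)` with respect to `M`:
the lower-left `(k-1)m × (k-1)n` block of `(M ⊗ I_m) Y`. -/
def Zmat1 {k m n : ℕ} (M : Matrix (Fin k) (Fin k) F)
    (Yc : Matrix (Fin k × Fin m) (Fin k × Fin n) F) :
    Matrix (Fin (k - 1) × Fin m) (Fin (k - 1) × Fin n) F :=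
  Matrix.of fun p q =>
    (kronId M * Yc : Matrix (Fin k × Fin m) (Fin k × Fin n) F)
      (⟨(p.1 : ℕ) + 1, by have := p.1.isLt; omega⟩, p.2)
      (⟨(q.1 : ℕ), by have := q.1.isLt; omega⟩, q.2)

/-- The `Z`-matrix of `L = λX + Y ∈ 𝕃₂(P)` with respect to `M̂`:
the upper-right `(k-1)m × (k-1)n` block of `Y (M̂ᵀ ⊗ I_n)`. -/
def Zmat2 {k m n : ℕ} (M : Matrix (Fin k) (Fin k) F)
    (Yc : Matrix (Fin k × Fin m) (Fin k × Fin n) F) :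
    Matrix (Fin (k - 1) × Fin m) (Fin (k - 1) × Fin n) F :=
  Matrix.of fun p q =>
    (Yc * kronId Mᵀ : Matrix (Fin k × Fin m) (Fin k × Fin n) F)
      (⟨(p.1 : ℕ), by have := p.1.isLt; omega⟩, p.2)
      (⟨(q.1 : ℕ) + 1, by have := q.1.isLt; omega⟩, q.2)

/-- `L = λX + Y ∈ 𝕃₁(P)` with right ansatz vector `v` has full `Z`-rank. -/
def FullZrank1 {k m n : ℕ} (Yc : Matrix (Fin k × Fin m) (Fin k × Fin n) F)
    (v : Fin k → F) : Prop :=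
  ∃ (M : Matrix (Fin k) (Fin k) F) (α : F),
    IsUnit M ∧ α ≠ 0 ∧ M.mulVec v = e1 α ∧ (Zmat1 M Yc).rank = (k - 1) * n

/-- `L = λX + Y ∈ 𝕃₂(P)` with left ansatz vector `w` has full `Z`-rank. -/
def FullZrank2 {k m n : ℕ} (Yc : Matrix (Fin k × Fin m) (Fin k × Fin n) F)
    (w : Fin k → F) : Prop :=
  ∃ (M : Matrix (Fin k) (Fin k) F) (α : F),
    IsUnit M ∧ α ≠ 0 ∧ M.mulVec w = e1 α ∧ (Zmat2 M Yc).rank = (k - 1) * m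

/-! ### null spaces, minimal bases and minimal indices over `F(λ)` -/

/-- A matrix polynomial viewed as a matrix over the field of rational functions. -/
def matRF {ρ γ : Type*} (P : Matrix ρ γ F[X]) : Matrix ρ γ (RatFunc F) :=
  P.map (algebraMap F[X] (RatFunc F))

/-- The right null space `N_r(P) = {x(λ) : P(λ) x(λ) ≡ 0}` over `F(λ)`. -/
def Nr {ρ γ : Type*} [Fintype γ] (P : Matrix ρ γ F[X]) :
    Submodule (RatFunc F) (γ → RatFunc F) :=
  LinearMap.ker (Matrix.mulVecLin (matRF P))

/-- The left null space `N_l(P) = {y(λ) : y(λ)ᵀ P(λ) ≡ 0}` over `F(λ)`. -/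
def Nl {ρ γ : Type*} [Fintype ρ] (P : Matrix ρ γ F[X]) :
    Submodule (RatFunc F) (ρ → RatFunc F) :=
  Nr Pᵀ

/-- The normal rank of a matrix polynomial: its rank over `F(λ)`. -/
def nrank {ρ γ : Type*} [Fintype γ] (P : Matrix ρ γ F[X]) : ℕ :=
  (matRF P).rank

/-- The rational vector determined by a vector polynomial. -/
def polyVec {γ : Type*} (x : γ → F[X]) : γ → RatFunc F :=
  fun i => algebraMap F[X] (RatFunc F) (x i)

/-- A rational vector is a vector polynomial if all its entries are polynomials. -/
def IsVecPoly {γ : Type*} (x : γ → RatFunc F) : Prop :=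
  ∃ p : γ → F[X], x = polyVec p

/-- The degree of a vector polynomial: the greatest degree of its components. -/
def polyVecDeg {γ : Type*} [Fintype γ] (x : γ → F[X]) : ℕ :=
  Finset.univ.sup fun i => (x i).natDegree

/-- A polynomial basis of the subspace `V` of `F(λ)^γ`. -/
def IsPolyBasis {γ ι : Type*} [Fintype γ]
    (V : Submodule (RatFunc F) (γ → RatFunc F)) (b : ι → γ → F[X]) : Prop :=
  LinearIndependent (RatFunc F) (fun i => polyVec (b i)) ∧
    Submodule.span (RatFunc F) (Set.range fun i => polyVec (b i)) = V

/-- A minimal basis of `V`: a polynomial basis of least order (sum of degrees). -/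
def IsMinimalBasis {γ ι : Type*} [Fintype γ] [Fintype ι]
    (V : Submodule (RatFunc F) (γ → RatFunc F)) (b : ι → γ → F[X]) : Prop :=
  IsPolyBasis V b ∧
    ∀ (d : ℕ) (b' : Fin d → γ → F[X]), IsPolyBasis V b' →
      ∑ i, polyVecDeg (b i) ≤ ∑ i, polyVecDeg (b' i)

/-- `ε` is the list of minimal indices of `V`: some minimal basis of `V` has
`ε` as its list of degrees. -/
def HasMinIndices {γ : Type*} [Fintype γ]
    (V : Submodule (RatFunc F) (γ → RatFunc F)) {d : ℕ} (ε : Fin d → ℕ) : Prop :=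
  ∃ b : Fin d → γ → F[X], IsMinimalBasis V b ∧ ∀ i, polyVecDeg (b i) = ε i

/-- `Λ_k(λ) ⊗ x(λ)`. -/
def lamTensor {n : ℕ} (k : ℕ) (x : Fin n → RatFunc F) : Fin k × Fin n → RatFunc F :=
  fun p => algebraMap F[X] (RatFunc F) (Polynomial.X ^ (k - 1 - (p.1 : ℕ))) * x p.2

/-- The matrix `vᵀ ⊗ I_m` over `F(λ)`; `𝓛_v(y) = (vproj v).mulVec y`. -/
def vproj {k m : ℕ} (v : Fin k → F) : Matrix (Fin m) (Fin k × Fin m) (RatFunc F) :=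
  Matrix.of fun r p =>
    if r = p.2 then algebraMap F[X] (RatFunc F) (Polynomial.C (v p.1)) else 0

/-- `(vᵀ ⊗ I_m) y` at the level of vector polynomials. -/
def LvPoly {k m : ℕ} (v : Fin k → F) (y : Fin k × Fin m → F[X]) : Fin m → F[X] :=
  fun r => ∑ i : Fin k, Polynomial.C (v i) * y (i, r)

/-- The rational subspace spanned by the rows of a matrix polynomial. -/
def rowSpan {ρ γ : Type*} [Fintype γ] (B : Matrix ρ γ F[X]) :
    Submodule (RatFunc F) (γ → RatFunc F) :=
  Submodule.span (RatFunc F) (Set.range fun i => polyVec (B i))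

/-- A matrix polynomial is a minimal basis if its rows form a minimal basis of the
rational subspace they span. -/
def IsMinimalBasisMat {ρ γ : Type*} [Fintype ρ] [Fintype γ] (B : Matrix ρ γ F[X]) : Prop :=
  IsMinimalBasis (rowSpan B) (fun i => B i)

/-- Dual minimal bases: `B ∈ F[λ]^{n₁×n}`, `C ∈ F[λ]^{n₂×n}` minimal bases with
`n₁ + n₂ = n` and `B Cᵀ = 0`. -/
def DualMinBases {ρ ρ' γ : Type*} [Fintype ρ] [Fintype ρ'] [Fintype γ]
    (B : Matrix ρ γ F[X]) (Cm : Matrix ρ' γ F[X]) : Prop :=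
  IsMinimalBasisMat B ∧ IsMinimalBasisMat Cm ∧
    Fintype.card ρ + Fintype.card ρ' = Fintype.card γ ∧ B * Cmᵀ = 0

/-! ### norms, singular values -/

/-- Square of the Frobenius norm of a constant matrix. -/
def frobSq {ρ γ : Type*} [Fintype ρ] [Fintype γ] (Ac : Matrix ρ γ F) : ℝ :=
  ∑ i, ∑ j, ‖Ac i j‖ ^ 2

/-- `‖λX + Y‖_F = sqrt(‖X‖_F² + ‖Y‖_F²)`. -/
def penFrob {ρ γ : Type*} [Fintype ρ] [Fintype γ] (Xc Yc : Matrix ρ γ F) : ℝ :=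
  Real.sqrt (frobSq Xc + frobSq Yc)

/-- `‖P‖_F = sqrt(∑ ‖A_i‖_F²)` for `P(λ) = ∑ λ^i A_i`. -/
def famFrob {k m n : ℕ} (A : Fin (k + 1) → Matrix (Fin m) (Fin n) F) : ℝ :=
  Real.sqrt (∑ i, frobSq (A i))

/-- `‖P‖_F` for a matrix polynomial of grade `g`. -/
def mpolyFrob {ρ γ : Type*} [Fintype ρ] [Fintype γ] (g : ℕ) (P : Matrix ρ γ F[X]) : ℝ :=
  Real.sqrt (∑ i, ∑ j, ∑ d ∈ Finset.range (g + 1), ‖(P i j).coeff d‖ ^ 2)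

/-- Square of the Euclidean norm of a vector. -/
def vecNormSq {ι : Type*} [Fintype ι] (x : ι → F) : ℝ := ∑ i, ‖x i‖ ^ 2

/-- The smallest singular value of a matrix. -/
def sigmaMin {ρ γ : Type*} [Fintype ρ] [Fintype γ] (Ac : Matrix ρ γ F) : ℝ :=
  if Fintype.card γ ≤ Fintype.card ρ then
    sInf {r : ℝ | ∃ x : γ → F, vecNormSq x = 1 ∧ r = Real.sqrt (vecNormSq (Ac.mulVec x))}
  else
    sInf {r : ℝ | ∃ y : ρ → F, vecNormSq y = 1 ∧ r = Real.sqrt (vecNormSq (Acᴴ.mulVec y))}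

/-- The spectral norm (2-norm) of a matrix. -/
def norm2 {ρ γ : Type*} [Fintype ρ] [Fintype γ] (Ac : Matrix ρ γ F) : ℝ :=
  sSup {r : ℝ | ∃ x : γ → F, vecNormSq x = 1 ∧ r = Real.sqrt (vecNormSq (Ac.mulVec x))}

/-- `κ₂(D) = ‖D‖₂ ‖D⁻¹‖₂`. -/
def cond2 {ρ : Type*} [Fintype ρ] [DecidableEq ρ] (Dc : Matrix ρ ρ F) : ℝ :=
  norm2 Dc * norm2 Dc⁻¹

/-! ### pencils used in the backward error analysis -/

/-- `B(λ) = λ [0 ∣ -R̃] + [R̃ ∣ 0]`, i.e. `R̃ (H_{k-1}(λ) ⊗ I_n)` up to sign conventions. -/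
def Bpencil {k n : ℕ} (R : Matrix (Fin (k - 1) × Fin n) (Fin (k - 1) × Fin n) F) :
    Matrix (Fin (k - 1) × Fin n) (Fin k × Fin n) F[X] :=
  Matrix.of fun p q =>
    (if h : (q.1 : ℕ) < k - 1 then Polynomial.C (R p (⟨(q.1 : ℕ), h⟩, q.2)) else 0) +
    (if h : 0 < (q.1 : ℕ) then
        Polynomial.X *
          Polynomial.C (-R p (⟨(q.1 : ℕ) - 1, by have := q.1.isLt; omega⟩, q.2))
      else 0)

/-- The coefficient of `λ` in `H_{k-1}(λ) ⊗ I_n`. -/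
def Hlam (F : Type*) [RCLike F] (k n : ℕ) :
    Matrix (Fin (k - 1) × Fin n) (Fin k × Fin n) F :=
  Matrix.of fun p q => if p.2 = q.2 ∧ (q.1 : ℕ) = (p.1 : ℕ) + 1 then 1 else 0

/-- The constant coefficient of `H_{k-1}(λ) ⊗ I_n`. -/
def Hconst (F : Type*) [RCLike F] (k n : ℕ) :
    Matrix (Fin (k - 1) × Fin n) (Fin k × Fin n) F :=
  Matrix.of fun p q => if p.2 = q.2 ∧ (q.1 : ℕ) = (p.1 : ℕ) then -1 else 0

/-- The convolution matrix `C_j(λ Xc + Yc)` of a pencil, with `j+1` block columns. -/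
def convPencil {ρ γ : Type*} (Xc Yc : Matrix ρ γ F) (j : ℕ) :
    Matrix (Fin (j + 2) × ρ) (Fin (j + 1) × γ) F :=
  Matrix.of fun r c =>
    if (r.1 : ℕ) = (c.1 : ℕ) then Xc r.2 c.2
    else if (r.1 : ℕ) = (c.1 : ℕ) + 1 then Yc r.2 c.2 else 0

/-- λ-coefficient of the trimmed pencil `L̂_t(λ)`:
`[[α A_k, X₁₂],[0, -R̃]]` with row split `m + (k-1)n`. -/
def LtX {k m n : ℕ} (α : F) (Ak : Matrix (Fin m) (Fin n) F)
    (X12 : Matrix (Fin m) (Fin (k - 1) × Fin n) F)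
    (R : Matrix (Fin (k - 1) × Fin n) (Fin (k - 1) × Fin n) F) :
    Matrix (Fin m ⊕ (Fin (k - 1) × Fin n)) (Fin k × Fin n) F :=
  Matrix.of fun s q =>
    Sum.elim
      (fun r => if h : (q.1 : ℕ) = 0 then α * Ak r q.2
        else X12 r (⟨(q.1 : ℕ) - 1, by have := q.1.isLt; omega⟩, q.2))
      (fun p => if h : (q.1 : ℕ) = 0 then 0
        else -R p (⟨(q.1 : ℕ) - 1, by have := q.1.isLt; omega⟩, q.2)) s

/-- Constant coefficient of the trimmed pencil `L̂_t(λ)`: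
`[[Y₁₁, α A₀],[R̃, 0]]` with row split `m + (k-1)n`. -/
def LtY {k m n : ℕ} (α : F) (A0 : Matrix (Fin m) (Fin n) F)
    (Y11 : Matrix (Fin m) (Fin (k - 1) × Fin n) F)
    (R : Matrix (Fin (k - 1) × Fin n) (Fin (k - 1) × Fin n) F) :
    Matrix (Fin m ⊕ (Fin (k - 1) × Fin n)) (Fin k × Fin n) F :=
  Matrix.of fun s q =>
    Sum.elim
      (fun r => if h : (q.1 : ℕ) < k - 1 then Y11 r (⟨(q.1 : ℕ), h⟩, q.2)
        else α * A0 r q.2)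
      (fun p => if h : (q.1 : ℕ) < k - 1 then R p (⟨(q.1 : ℕ), h⟩, q.2) else 0) s

/-! ### trimming -/

/-- The rows `[0 ∣ Q₂*] (M ⊗ I_m)`. -/
def bottomRows {k m n c : ℕ} (M : Matrix (Fin k) (Fin k) F)
    (Q : Matrix (Fin (k - 1) × Fin m) ((Fin (k - 1) × Fin n) ⊕ Fin c) F) :
    Matrix (Fin c) (Fin k × Fin m) F :=
  (Matrix.of fun (j : Fin c) (p : Fin k × Fin m) =>
      if h : (p.1 : ℕ) = 0 then 0
      else star (Q (⟨(p.1 : ℕ) - 1, by have := p.1.isLt; omega⟩, p.2) (Sum.inr j)))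
    * kronId M

/-- The square matrix `[D ; [0 ∣ Q₂*](M ⊗ I_m)]` whose invertibility makes `D` admissible. -/
def trimAux {k m n c : ℕ} (M : Matrix (Fin k) (Fin k) F)
    (Q : Matrix (Fin (k - 1) × Fin m) ((Fin (k - 1) × Fin n) ⊕ Fin c) F)
    (D : Matrix (Fin m ⊕ (Fin (k - 1) × Fin n)) (Fin k × Fin m) F) :
    Matrix ((Fin m ⊕ (Fin (k - 1) × Fin n)) ⊕ Fin c) (Fin k × Fin m) F :=
  Matrix.of (Sum.elim (fun i j => D i j) (fun i j => bottomRows M Q i j))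

/-- The columns `(M̂ᵀ ⊗ I_n) [0 ; Q₂]`. -/
def rightCols {k m n c : ℕ} (M : Matrix (Fin k) (Fin k) F)
    (Q : Matrix (Fin (k - 1) × Fin n) ((Fin (k - 1) × Fin m) ⊕ Fin c) F) :
    Matrix (Fin k × Fin n) (Fin c) F :=
  kronId Mᵀ *
    (Matrix.of fun (q : Fin k × Fin n) (j : Fin c) =>
      if h : (q.1 : ℕ) = 0 then 0
      else Q (⟨(q.1 : ℕ) - 1, by have := q.1.isLt; omega⟩, q.2) (Sum.inr j))

/-- The square matrix `[D̂ ∣ (M̂ᵀ ⊗ I_n)[0 ; Q₂]]` whose invertibility makes `D̂` admissible. -/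
def trimAux2 {k m n c : ℕ} (M : Matrix (Fin k) (Fin k) F)
    (Q : Matrix (Fin (k - 1) × Fin n) ((Fin (k - 1) × Fin m) ⊕ Fin c) F)
    (D : Matrix (Fin k × Fin n) (Fin n ⊕ (Fin (k - 1) × Fin m)) F) :
    Matrix (Fin k × Fin n) ((Fin n ⊕ (Fin (k - 1) × Fin m)) ⊕ Fin c) F :=
  Matrix.of fun q s => Sum.elim (fun t => D q t) (fun j => rightCols M Q q j) s

/-! ### Transport of minimal indices -/

theorem polyVec_injective {γ : Type*} :
    Function.Injective (polyVec : (γ → F[X]) → γ → RatFunc F) := fun _ _ h =>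
  funext fun i => IsFractionRing.injective F[X] (RatFunc F) (congrFun h i)

theorem polyVec_zero {γ : Type*} : polyVec (0 : γ → F[X]) = 0 := by
  ext i; simp [polyVec]

theorem polyVec_mulVec {ρ γ : Type*} [Fintype γ] (G : Matrix ρ γ F[X]) (p : γ → F[X]) :
    polyVec (G *ᵥ p) = matRF G *ᵥ polyVec p := by
  ext i
  simp [polyVec, matRF, Matrix.mulVec, dotProduct, map_sum]

theorem matRF_mul {ρ γ κ : Type*} [Fintype γ] (G : Matrix ρ γ F[X]) (H : Matrix γ κ F[X]) :
    matRF (G * H) = matRF G * matRF H := Matrix.map_mul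

theorem matRF_one {γ : Type*} [DecidableEq γ] : matRF (1 : Matrix γ γ F[X]) = 1 :=
  Matrix.map_one _ (map_zero _) (map_one _)

theorem matRF_add {ρ γ : Type*} (G H : Matrix ρ γ F[X]) :
    matRF (G + H) = matRF G + matRF H := Matrix.map_add _ (map_add _) _ _

theorem mem_Nr {ρ γ : Type*} [Fintype γ] {P : Matrix ρ γ F[X]} {x : γ → RatFunc F} :
    x ∈ Nr P ↔ matRF P *ᵥ x = 0 := by simp [Nr]

theorem polyVec_mem_Nr {ρ γ : Type*} [Fintype γ] {P : Matrix ρ γ F[X]} {p : γ → F[X]} :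
    polyVec p ∈ Nr P ↔ P *ᵥ p = 0 := by
  rw [mem_Nr, ← polyVec_mulVec, ← polyVec_zero, polyVec_injective.eq_iff]

theorem IsPolyBasis.mem {γ ι : Type*} [Fintype γ]
    {V : Submodule (RatFunc F) (γ → RatFunc F)} {b : ι → γ → F[X]} (hb : IsPolyBasis V b)
    (i : ι) : polyVec (b i) ∈ V :=
  hb.2 ▸ Submodule.subset_span ⟨i, rfl⟩

theorem IsPolyBasis.ne_zero {γ ι : Type*} [Fintype γ]
    {V : Submodule (RatFunc F) (γ → RatFunc F)} {b : ι → γ → F[X]} (hb : IsPolyBasis V b)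
    (i : ι) : b i ≠ 0 := fun h => hb.1.ne_zero i (by simp [h, polyVec_zero])

theorem IsPolyBasis.card_eq {γ : Type*} [Fintype γ]
    {V : Submodule (RatFunc F) (γ → RatFunc F)} {d d' : ℕ} {b : Fin d → γ → F[X]}
    {b' : Fin d' → γ → F[X]} (hb : IsPolyBasis V b) (hb' : IsPolyBasis V b') : d = d' := by
  have h := finrank_span_eq_card hb.1
  have h' := finrank_span_eq_card hb'.1
  rw [hb.2] at h
  rw [hb'.2] at h'
  simpa using h.symm.trans h'

/-- If the polynomial matrices `G` and `G'` induce mutually inverse bijections between the null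
spaces of `P` and `L`, and `G` raises the degree of every null vector by `c`, then it shifts
the minimal indices by `c`. -/
theorem hasMinIndices_iff_add {ρ γ ρ' γ' : Type*} [Fintype ρ] [Fintype γ] [Fintype ρ']
    [Fintype γ'] [DecidableEq γ] [DecidableEq γ'] {P : Matrix ρ γ F[X]} {L : Matrix ρ' γ' F[X]}
    {G : Matrix γ' γ F[X]} {G' : Matrix γ γ' F[X]} {U : Matrix ρ' ρ F[X]}
    {U' : Matrix ρ ρ' F[X]} {M : Matrix γ' ρ' F[X]}
    (hLG : L * G = U * P) (hPG : P * G' = U' * L) (hG : G' * G = 1) (hG' : G * G' = 1 + M * L)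
    (c : ℕ) (hdeg : ∀ p, P *ᵥ p = 0 → p ≠ 0 → polyVecDeg (G *ᵥ p) = polyVecDeg p + c)
    {d : ℕ} (ε : Fin d → ℕ) :
    HasMinIndices (Nr P) ε ↔ HasMinIndices (Nr L) fun i => ε i + c := by
  have hback : ∀ z ∈ Nr L, matRF G *ᵥ (matRF G' *ᵥ z) = z := fun z hz => by
    rw [mulVec_mulVec, ← matRF_mul, hG', matRF_add, matRF_one, matRF_mul, add_mulVec,
      one_mulVec, ← mulVec_mulVec, mem_Nr.1 hz, mulVec_zero, add_zero]
  have hmem' : ∀ z ∈ Nr L, matRF G' *ᵥ z ∈ Nr P := fun z hz => by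
    rw [mem_Nr, mulVec_mulVec, ← matRF_mul, hPG, matRF_mul, ← mulVec_mulVec, mem_Nr.1 hz,
      mulVec_zero]
  have hmem : ∀ x ∈ Nr P, matRF G *ᵥ x ∈ Nr L := fun x hx => by
    rw [mem_Nr, mulVec_mulVec, ← matRF_mul, hLG, matRF_mul, ← mulVec_mulVec, mem_Nr.1 hx,
      mulVec_zero]
  have hleft : ∀ x, matRF G' *ᵥ (matRF G *ᵥ x) = x := fun x => by
    rw [mulVec_mulVec, ← matRF_mul, hG, matRF_one, one_mulVec]
  have hmap : (Nr P).map (mulVecLin (matRF G)) = Nr L := by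
    ext z
    constructor
    · rintro ⟨x, hx, rfl⟩
      exact hmem x hx
    · exact fun hz => ⟨_, hmem' z hz, hback z hz⟩
  have hmap' : (Nr L).map (mulVecLin (matRF G')) = Nr P := by
    ext x
    constructor
    · rintro ⟨z, hz, rfl⟩
      exact hmem' z hz
    · exact fun hx => ⟨_, hmem x hx, hleft x⟩
  have push : ∀ {e : ℕ} {b : Fin e → γ → F[X]}, IsPolyBasis (Nr P) b →
      IsPolyBasis (Nr L) fun i => G *ᵥ b i := by
    intro e b hb
    have hfun : (fun i => polyVec (G *ᵥ b i)) =
        mulVecLin (matRF G) ∘ fun i => polyVec (b i) := by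
      funext i; simp [polyVec_mulVec]
    constructor
    · rw [hfun]
      refine hb.1.map' _ (LinearMap.ker_eq_bot.2 ?_)
      exact Function.LeftInverse.injective (g := fun z => matRF G' *ᵥ z) hleft
    · rw [hfun, Set.range_comp, ← Submodule.map_span, hb.2, hmap]
  have pull : ∀ {e : ℕ} {b : Fin e → γ' → F[X]}, IsPolyBasis (Nr L) b →
      IsPolyBasis (Nr P) fun i => G' *ᵥ b i := by
    intro e b hb
    have hfun : (fun i => polyVec (G' *ᵥ b i)) =
        mulVecLin (matRF G') ∘ fun i => polyVec (b i) := by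
      funext i; simp [polyVec_mulVec]
    constructor
    · refine LinearIndependent.of_comp (mulVecLin (matRF G)) ?_
      convert hb.1 using 1
      funext i
      simp only [Function.comp_apply, mulVecLin_apply, polyVec_mulVec]
      exact hback _ (hb.mem i)
    · rw [hfun, Set.range_comp, ← Submodule.map_span, hb.2, hmap']
  have deg_push : ∀ {e : ℕ} {b : Fin e → γ → F[X]}, IsPolyBasis (Nr P) b → ∀ i,
      polyVecDeg (G *ᵥ b i) = polyVecDeg (b i) + c := fun hb i =>
    hdeg _ (polyVec_mem_Nr.1 (hb.mem i)) (hb.ne_zero i)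
  have deg_pull : ∀ {e : ℕ} {b : Fin e → γ' → F[X]}, IsPolyBasis (Nr L) b → ∀ i,
      polyVecDeg (b i) = polyVecDeg (G' *ᵥ b i) + c := fun {e b} hb i => by
    rw [← deg_push (pull hb) i]
    congr 1
    apply polyVec_injective
    rw [polyVec_mulVec, polyVec_mulVec]
    exact (hback _ (hb.mem i)).symm
  constructor
  · rintro ⟨b, ⟨hb, hmin⟩, hε⟩
    refine ⟨fun i => G *ᵥ b i, ⟨push hb, fun d' b' hb' => ?_⟩, fun i => ?_⟩
    · obtain rfl := (push hb).card_eq hb'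
      simp only [deg_push hb, deg_pull hb', Finset.sum_add_distrib]
      exact Nat.add_le_add_right (hmin _ _ (pull hb')) _
    · rw [deg_push hb, hε]
  · rintro ⟨b, ⟨hb, hmin⟩, hε⟩
    refine ⟨fun i => G' *ᵥ b i, ⟨pull hb, fun d' b' hb' => ?_⟩, fun i => ?_⟩
    · obtain rfl := (pull hb).card_eq hb'
      have := hmin _ _ (push hb')
      simp only [deg_push hb', deg_pull hb, Finset.sum_add_distrib] at this
      exact Nat.le_of_add_le_add_right this
    · exact Nat.add_right_cancel ((deg_pull hb i).symm.trans (hε i))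

theorem natDegree_le_polyVecDeg {γ : Type*} [Fintype γ] (x : γ → F[X]) (i : γ) :
    (x i).natDegree ≤ polyVecDeg x :=
  Finset.le_sup (f := fun i => (x i).natDegree) (Finset.mem_univ i)

theorem polyVecDeg_le {γ : Type*} [Fintype γ] {x : γ → F[X]} {N : ℕ}
    (h : ∀ i, (x i).natDegree ≤ N) : polyVecDeg x ≤ N :=
  Finset.sup_le fun i _ => h i

theorem polyVecDeg_mulVec_map_C_le {ρ γ : Type*} [Fintype ρ] [Fintype γ] (T : Matrix ρ γ F)
    (p : γ → F[X]) : polyVecDeg (T.map C *ᵥ p) ≤ polyVecDeg p := by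
  refine polyVecDeg_le fun i => natDegree_sum_le_of_forall_le _ _ fun j _ => ?_
  exact (natDegree_C_mul_le _ _).trans (natDegree_le_polyVecDeg p j)

/-- Minimal indices are invariant under strict equivalence. -/
theorem hasMinIndices_mul_mul_iff {ρ γ : Type*} [Fintype ρ] [Fintype γ] [DecidableEq ρ]
    [DecidableEq γ] {S S' : Matrix ρ ρ F} {T T' : Matrix γ γ F} (hS : S' * S = 1)
    (hT : T * T' = 1) (L : Matrix ρ γ F[X]) {d : ℕ} (ε : Fin d → ℕ) :
    HasMinIndices (Nr L) ε ↔ HasMinIndices (Nr (S.map C * L * T.map C)) ε := by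
  have hT' : T' * T = 1 := mul_eq_one_comm.1 hT
  have hSC : S'.map C * S.map C = (1 : Matrix ρ ρ F[X]) := by
    rw [← Matrix.map_mul, hS, Matrix.map_one _ (map_zero _) (map_one _)]
  have hTC : T.map C * T'.map C = (1 : Matrix γ γ F[X]) := by
    rw [← Matrix.map_mul, hT, Matrix.map_one _ (map_zero _) (map_one _)]
  have hTC' : T'.map C * T.map C = (1 : Matrix γ γ F[X]) := mul_eq_one_comm.1 hTC
  refine hasMinIndices_iff_add (P := L) (G := T'.map C) (G' := T.map C) (U := S.map C)
    (U' := S'.map C) (M := 0) ?_ ?_ hTC ?_ 0 (fun p _ _ => ?_) ε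
  · rw [Matrix.mul_assoc _ _ (T'.map C), hTC, Matrix.mul_one]
  · rw [← Matrix.mul_assoc, ← Matrix.mul_assoc, hSC, Matrix.one_mul]
  · rw [hTC', Matrix.zero_mul, add_zero]
  · refine le_antisymm (polyVecDeg_mulVec_map_C_le _ _) ?_
    have := polyVecDeg_mulVec_map_C_le T (T'.map C *ᵥ p)
    rwa [mulVec_mulVec, hTC, one_mulVec] at this
/-! ### Pencils and strict equivalence -/

theorem pencil_eq {ρ γ : Type*} (Xc Yc : Matrix ρ γ F) :
    pencil Xc Yc = (X : F[X]) • Xc.map C + Yc.map C := by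
  ext1 i j
  simp only [pencil, of_apply, Matrix.add_apply, Matrix.smul_apply, map_apply, smul_eq_mul,
    X_mul]

theorem pencil_mul_mul {ρ ρ' γ γ' : Type*} [Fintype ρ] [Fintype γ] (S : Matrix ρ' ρ F)
    (Xc Yc : Matrix ρ γ F) (T : Matrix γ γ' F) :
    pencil (S * Xc * T) (S * Yc * T) = S.map C * pencil Xc Yc * T.map C := by
  simp only [pencil_eq, Matrix.map_mul, Matrix.mul_add, Matrix.add_mul, Matrix.mul_smul,
    Matrix.smul_mul]

theorem pencil_fromRows {ρ ρ' γ : Type*} (X₁ Y₁ : Matrix ρ γ F) (X₂ Y₂ : Matrix ρ' γ F) :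
    pencil (fromRows X₁ X₂) (fromRows Y₁ Y₂) = fromRows (pencil X₁ Y₁) (pencil X₂ Y₂) := by
  ext1 i j
  cases i <;> simp [pencil]

theorem revMat_pencil {ρ γ : Type*} (Xc Yc : Matrix ρ γ F) :
    revMat 1 (pencil Xc Yc) = pencil Yc Xc := by
  ext1 i j
  have h1 := reflect_C_mul_X_pow (c := Xc i j) 1 1
  have h0 := reflect_C_mul_X_pow (c := Yc i j) 1 0
  simp only [pow_one, pow_zero, mul_one, Polynomial.revAt_le le_rfl,
    Polynomial.revAt_le (Nat.zero_le 1), Nat.sub_self, Nat.sub_zero] at h0 h1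
  simp only [revMat, pencil, map_apply, of_apply, reflect_add, h1, h0]
  exact add_comm _ _

/-- A matrix polynomial that is unimodularly equivalent to `diag(P, I)`, with arbitrary index
types, is a linearization of `P`. -/
theorem isLin_of_equivalence {m n s : ℕ} {P : Matrix (Fin m) (Fin n) F[X]} {ρ γ σ : Type*}
    [Fintype ρ] [DecidableEq ρ] [Fintype γ] [DecidableEq γ] [Fintype σ] [DecidableEq σ]
    {L : Matrix ρ γ F[X]} (eσ : σ ≃ Fin s) (er : ρ ≃ Fin m ⊕ σ) (ec : γ ≃ Fin n ⊕ σ)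
    {E : Matrix (Fin m ⊕ σ) ρ F[X]} {E' : Matrix ρ (Fin m ⊕ σ) F[X]}
    {G : Matrix γ (Fin n ⊕ σ) F[X]} {G' : Matrix (Fin n ⊕ σ) γ F[X]}
    (hE : E * E' = 1) (hG : G' * G = 1) (h : E * L * G = fromBlocks P 0 0 1) :
    IsLin s P L := by
  let fr : Fin m ⊕ σ ≃ Fin m ⊕ Fin s := (Equiv.refl _).sumCongr eσ
  let fc : Fin n ⊕ σ ≃ Fin n ⊕ Fin s := (Equiv.refl _).sumCongr eσ
  refine ⟨er.trans fr, ec.trans fc, reindex fr (er.trans fr) E, reindex (ec.trans fc) fc G,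
    ?_, ?_, ?_⟩
  · apply isUnit_det_of_right_inverse (B := reindex (er.trans fr) fr E')
    simp only [reindex_apply, submatrix_mul_equiv, hE, submatrix_one_equiv]
  · apply isUnit_det_of_left_inverse (B := reindex fc (ec.trans fc) G')
    simp only [reindex_apply, submatrix_mul_equiv, hG, submatrix_one_equiv]
  · simp only [reindex_apply, submatrix_mul_equiv, h]
    ext1 i j
    rcases i with i | i <;> rcases j with j | j <;>
      simp [fr, fc, Matrix.one_apply, eσ.symm.injective.eq_iff]

/-! ### The Kronecker pencil and its dual basis -/

/-- The matrix `[I 0]` selecting all block rows but the last. -/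
def selInit (F : Type*) [RCLike F] (K n : ℕ) : Matrix (Fin K × Fin n) (Fin (K + 1) × Fin n) F :=
  Matrix.of fun p q => if (p.1.castSucc, p.2) = q then 1 else 0

/-- The matrix `[0 I]` selecting all block rows but the first. -/
def selTail (F : Type*) [RCLike F] (K n : ℕ) : Matrix (Fin K × Fin n) (Fin (K + 1) × Fin n) F :=
  Matrix.of fun p q => if (p.1.succ, p.2) = q then 1 else 0

/-- The Kronecker pencil `[I 0] - λ [0 I]`. -/
def kron (F : Type*) [RCLike F] (K n : ℕ) :
    Matrix (Fin K × Fin n) (Fin (K + 1) × Fin n) F[X] :=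
  pencil (-selTail F K n) (selInit F K n)

/-- A polynomial right inverse of the Kronecker pencil. -/
def kronInv (F : Type*) [RCLike F] (K n : ℕ) :
    Matrix (Fin (K + 1) × Fin n) (Fin K × Fin n) F[X] :=
  Matrix.of fun q p => if q.2 = p.2 ∧ (q.1 : ℕ) ≤ p.1 then X ^ ((p.1 : ℕ) - q.1) else 0

/-- The matrix `[0 I_n]` selecting the last block row. -/
def selLast (F : Type*) [RCLike F] (K n : ℕ) : Matrix (Fin n) (Fin (K + 1) × Fin n) F[X] :=
  Matrix.of fun c q => if (Fin.last K, c) = q then 1 else 0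

theorem selInit_mul_apply {K n : ℕ} {κ : Type*} (M : Matrix (Fin (K + 1) × Fin n) κ F)
    (p : Fin K × Fin n) (c : κ) : (selInit F K n * M) p c = M (p.1.castSucc, p.2) c := by
  simp [selInit, Matrix.mul_apply]

theorem selTail_mul_apply {K n : ℕ} {κ : Type*} (M : Matrix (Fin (K + 1) × Fin n) κ F)
    (p : Fin K × Fin n) (c : κ) : (selTail F K n * M) p c = M (p.1.succ, p.2) c := by
  simp [selTail, Matrix.mul_apply]

theorem kron_mul_apply {K n : ℕ} {κ : Type*} (M : Matrix (Fin (K + 1) × Fin n) κ F[X])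
    (p : Fin K × Fin n) (c : κ) :
    (kron F K n * M) p c = M (p.1.castSucc, p.2) c - X * M (p.1.succ, p.2) c := by
  simp [kron, pencil, selInit, selTail, Matrix.mul_apply, add_mul, Finset.sum_add_distrib,
    apply_ite C, sub_eq_neg_add]

theorem selLast_mul_apply {K n : ℕ} {κ : Type*} (M : Matrix (Fin (K + 1) × Fin n) κ F[X])
    (p : Fin n) (c : κ) : (selLast F K n * M) p c = M (Fin.last K, p) c := by
  simp [selLast, Matrix.mul_apply]

theorem kron_mul_kronInv (K n : ℕ) : kron F K n * kronInv F K n = 1 := by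
  ext1 p q
  obtain ⟨i, a⟩ := p
  obtain ⟨j, b⟩ := q
  rw [kron_mul_apply]
  simp only [kronInv, of_apply, Matrix.one_apply, Prod.mk.injEq, Fin.val_castSucc, Fin.val_succ]
  by_cases hab : a = b
  · rcases lt_trichotomy (i : ℕ) j with h | h | h
    · obtain ⟨t, ht⟩ := Nat.exists_eq_add_of_lt h
      have h1 : (j : ℕ) - i = t + 1 := by omega
      have h2 : (j : ℕ) - (i + 1) = t := by omega
      have h3 : i ≠ j := by rintro rfl; omega
      rw [if_pos ⟨hab, h.le⟩, if_pos ⟨hab, h⟩, if_neg (by tauto), h1, h2]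
      ring
    · have h3 : i = j := Fin.ext h
      simp [hab, h3]
    · have h3 : i ≠ j := by rintro rfl; omega
      rw [if_neg (by omega), if_neg (by omega), if_neg (by tauto)]
      ring
  · simp [hab]

theorem kron_mul_Lam (K n : ℕ) : kron F K n * Lam F (K + 1) n = 0 := by
  ext1 p c
  obtain ⟨i, a⟩ := p
  rw [kron_mul_apply]
  simp only [Lam, of_apply, Fin.val_castSucc, Fin.val_succ, Matrix.zero_apply]
  split_ifs
  · have h : K + 1 - 1 - (i : ℕ) = K + 1 - 1 - (i + 1) + 1 := by omega
    rw [h]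
    ring
  · ring

theorem selLast_mul_kronInv (K n : ℕ) : selLast F K n * kronInv F K n = 0 := by
  ext1 p q
  rw [selLast_mul_apply]
  simp only [kronInv, of_apply, Fin.val_last, Matrix.zero_apply]
  rw [if_neg (by omega)]

theorem selLast_mul_Lam (K n : ℕ) : selLast F K n * Lam F (K + 1) n = 1 := by
  ext1 p q
  rw [selLast_mul_apply]
  simp [Lam, Matrix.one_apply]

/-- An identification of the column indices of a pencil in block form. -/
def colEquiv (K n : ℕ) : Fin (K + 1) × Fin n ≃ Fin n ⊕ (Fin K × Fin n) :=
  Fintype.equivOfCardEq (by simp; ring)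

theorem fromCols_mul_fromRows_Lam (K n : ℕ) :
    fromCols (Lam F (K + 1) n) (kronInv F K n) * fromRows (selLast F K n) (kron F K n) = 1 := by
  rw [mul_eq_one_comm_of_equiv (colEquiv K n), fromRows_mul_fromCols, selLast_mul_Lam,
    selLast_mul_kronInv, kron_mul_Lam, kron_mul_kronInv, fromBlocks_one]

theorem Lam_mul_selLast (K n : ℕ) :
    Lam F (K + 1) n * selLast F K n = 1 - kronInv F K n * kron F K n := by
  have h := fromCols_mul_fromRows_Lam (F := F) K n
  rw [fromCols_mul_fromRows] at h
  exact eq_sub_of_add_eq h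

/-! ### The block pencils `[A(λ); [I 0] - λ [0 I]]` -/

/-- The matrix polynomial `[A(λ); [I 0] - λ [0 I]]`. -/
def corePencil {K m n : ℕ} (Am : Matrix (Fin m) (Fin (K + 1) × Fin n) F[X]) :
    Matrix (Fin m ⊕ (Fin K × Fin n)) (Fin (K + 1) × Fin n) F[X] :=
  fromRows Am (kron F K n)

/-- The matrix polynomial `[I  -A(λ) N(λ)]`, where `N` is the right inverse of the Kronecker
pencil; it lifts left null vectors. -/
def leftLift {K m n : ℕ} (Am : Matrix (Fin m) (Fin (K + 1) × Fin n) F[X]) :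
    Matrix (Fin m) (Fin m ⊕ (Fin K × Fin n)) F[X] :=
  fromCols 1 (-(Am * kronInv F K n))

theorem leftLift_mul_corePencil {K m n : ℕ} (Am : Matrix (Fin m) (Fin (K + 1) × Fin n) F[X]) :
    leftLift Am * corePencil Am = Am * Lam F (K + 1) n * selLast F K n := by
  rw [leftLift, corePencil, fromCols_mul_fromRows, Matrix.mul_assoc, Lam_mul_selLast,
    Matrix.mul_sub, Matrix.one_mul, Matrix.mul_one, Matrix.neg_mul, Matrix.mul_assoc,
    sub_eq_add_neg]

theorem corePencil_mul_Lam {K m n : ℕ} (Am : Matrix (Fin m) (Fin (K + 1) × Fin n) F[X]) :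
    corePencil Am * Lam F (K + 1) n =
      (fromRows 1 0 : Matrix (Fin m ⊕ (Fin K × Fin n)) (Fin m) F[X]) *
        (Am * Lam F (K + 1) n) := by
  rw [corePencil, fromRows_mul, kron_mul_Lam, fromRows_mul, Matrix.one_mul, Matrix.zero_mul]

theorem isLin_corePencil {K m n : ℕ} (Am : Matrix (Fin m) (Fin (K + 1) × Fin n) F[X])
    {S S' : Matrix (Fin m ⊕ (Fin K × Fin n)) (Fin m ⊕ (Fin K × Fin n)) F}
    {T T' : Matrix (Fin (K + 1) × Fin n) (Fin (K + 1) × Fin n) F}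
    (hS : S' * S = 1) (hT : T * T' = 1) :
    IsLin (K * n) (Am * Lam F (K + 1) n) (S.map C * corePencil Am * T.map C) := by
  have hSC : S'.map C * S.map C = (1 : Matrix _ _ F[X]) := by
    rw [← Matrix.map_mul, hS, Matrix.map_one _ (map_zero _) (map_one _)]
  have hTC : T.map C * T'.map C = (1 : Matrix _ _ F[X]) := by
    rw [← Matrix.map_mul, hT, Matrix.map_one _ (map_zero _) (map_one _)]
  have hUV := (mul_eq_one_comm_of_equiv (colEquiv K n)).1
    (fromCols_mul_fromRows_Lam (F := F) K n)
  refine isLin_of_equivalence finProdFinEquiv (Equiv.refl _) (colEquiv K n)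
    (E := fromBlocks 1 (-(Am * kronInv F K n)) 0 1 * S'.map C)
    (E' := S.map C * fromBlocks 1 (Am * kronInv F K n) 0 1)
    (G := T'.map C * fromCols (Lam F (K + 1) n) (kronInv F K n))
    (G' := fromRows (selLast F K n) (kron F K n) * T.map C) ?_ ?_ ?_
  · rw [Matrix.mul_assoc, ← Matrix.mul_assoc (S'.map C), hSC, Matrix.one_mul,
      fromBlocks_multiply]
    simp
  · rw [Matrix.mul_assoc, ← Matrix.mul_assoc (T.map C), hTC, Matrix.one_mul, hUV]
  · have h : (fromBlocks 1 (-(Am * kronInv F K n)) 0 1 :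
          Matrix (Fin m ⊕ (Fin K × Fin n)) (Fin m ⊕ (Fin K × Fin n)) F[X]) *
        (corePencil Am * fromCols (Lam F (K + 1) n) (kronInv F K n)) =
          fromBlocks (Am * Lam F (K + 1) n) 0 0 1 := by
      rw [corePencil, fromRows_mul_fromCols, kron_mul_Lam, kron_mul_kronInv,
        fromBlocks_multiply]
      simp
    rw [← h]
    simp only [Matrix.mul_assoc]
    rw [← Matrix.mul_assoc (S'.map C), hSC, Matrix.one_mul, ← Matrix.mul_assoc (T.map C), hTC,
      Matrix.one_mul]

theorem hasMinIndices_Nr_corePencil {K m n : ℕ} (Am : Matrix (Fin m) (Fin (K + 1) × Fin n) F[X])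
    {d : ℕ} (ε : Fin d → ℕ) :
    HasMinIndices (Nr (Am * Lam F (K + 1) n)) ε ↔
      HasMinIndices (Nr (corePencil Am)) fun i => ε i + K := by
  refine hasMinIndices_iff_add (G := Lam F (K + 1) n) (G' := selLast F K n)
    (U := fromRows 1 0) (U' := leftLift Am)
    (M := fromCols 0 (-kronInv F K n)) (corePencil_mul_Lam Am)
    (leftLift_mul_corePencil Am).symm (selLast_mul_Lam K n) ?_ K (fun p _ hp => ?_) ε
  · rw [corePencil, fromCols_mul_fromRows, Lam_mul_selLast, Matrix.zero_mul, zero_add,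
      Matrix.neg_mul, sub_eq_add_neg]
  · have happ : ∀ q, (Lam F (K + 1) n *ᵥ p) q = X ^ (K - (q.1 : ℕ)) * p q.2 := fun q => by
      simp [Lam, Matrix.mulVec, dotProduct]
    refine le_antisymm (polyVecDeg_le fun q => ?_) ?_
    · rw [happ]
      refine natDegree_mul_le.trans ?_
      have := natDegree_le_polyVecDeg p q.2
      rw [natDegree_X_pow]
      omega
    · obtain ⟨i₀, hi₀⟩ : ∃ i, p i ≠ 0 := by
        by_contra! h
        exact hp (funext h)
      obtain ⟨j, -, hj⟩ := Finset.exists_mem_eq_sup Finset.univ ⟨i₀, Finset.mem_univ _⟩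
        fun i => (p i).natDegree
      obtain ⟨i, hi, hdeg⟩ : ∃ i, p i ≠ 0 ∧ (p i).natDegree = polyVecDeg p := by
        by_cases h : p j = 0
        · refine ⟨i₀, hi₀, le_antisymm (natDegree_le_polyVecDeg p i₀) ?_⟩
          rw [polyVecDeg, hj, h]
          simp
        · exact ⟨j, h, hj.symm⟩
      have h := natDegree_le_polyVecDeg (Lam F (K + 1) n *ᵥ p) (0, i)
      rw [happ, natDegree_mul (by simp) hi, natDegree_X_pow, hdeg] at h
      simpa [add_comm] using h

theorem hasMinIndices_Nl_corePencil {K m n : ℕ} (Xc Yc : Matrix (Fin m) (Fin (K + 1) × Fin n) F)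
    {d : ℕ} (δ : Fin d → ℕ) :
    HasMinIndices (Nl (pencil Xc Yc * Lam F (K + 1) n)) δ ↔
      HasMinIndices (Nl (corePencil (pencil Xc Yc))) δ := by
  set Am := pencil Xc Yc with hAm
  refine hasMinIndices_iff_add (G := (leftLift Am)ᵀ)
    (G' := (fromRows 1 0)ᵀ) (U := (selLast F K n)ᵀ) (U' := (Lam F (K + 1) n)ᵀ)
    (M := (fromCols 0 (-kronInv F K n))ᵀ) ?_ ?_ ?_ ?_ 0 (fun y hy _ => ?_) δ
  · rw [← transpose_mul, ← transpose_mul, leftLift_mul_corePencil]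
  · rw [← transpose_mul, ← transpose_mul, corePencil_mul_Lam]
  · rw [← transpose_mul, leftLift, fromCols_mul_fromRows, Matrix.mul_one, Matrix.mul_zero,
      add_zero, transpose_one]
  · rw [← transpose_mul, ← transpose_mul, leftLift, corePencil, fromRows_mul_fromCols,
      fromRows_mul_fromCols, ← fromBlocks_one]
    simp only [Matrix.mul_neg, Matrix.one_mul, Matrix.zero_mul, Matrix.mul_zero,
      kron_mul_kronInv, fromBlocks_transpose, transpose_zero, transpose_one, neg_zero]
    rw [fromBlocks_add]
    simp
  · rw [add_zero]
    set w : Fin K × Fin n → F[X] := (-(Am * kronInv F K n))ᵀ *ᵥ y with hw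
    have hz : (leftLift Am)ᵀ *ᵥ y = Sum.elim y w := by
      rw [leftLift, transpose_fromCols, fromRows_mulVec, transpose_one, one_mulVec]
    have hnull : Amᵀ *ᵥ y + (kron F K n)ᵀ *ᵥ w = 0 := by
      rw [hw, mulVec_mulVec, ← add_mulVec, ← transpose_mul, ← transpose_add]
      have : Am + -(Am * kronInv F K n) * kron F K n = Am * Lam F (K + 1) n * selLast F K n := by
        rw [← leftLift_mul_corePencil, leftLift, corePencil, fromCols_mul_fromRows, Matrix.one_mul]
      rw [this, transpose_mul, ← mulVec_mulVec, hy, mulVec_zero]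
    have hAdeg : ∀ q, ((Amᵀ *ᵥ y) q).natDegree ≤ polyVecDeg y + 1 := fun q => by
      simp only [Matrix.mulVec, dotProduct]
      refine natDegree_sum_le_of_forall_le _ _ fun i _ => natDegree_mul_le.trans ?_
      have h1 := natDegree_le_polyVecDeg y i
      have h2 : (Amᵀ q i).natDegree ≤ 1 := by
        simp only [hAm, pencil, transpose_apply, of_apply]
        exact natDegree_linear_le
      omega
    have hkron : ∀ (i : Fin K) (a : Fin n), ((kron F K n)ᵀ *ᵥ w) (i.succ, a) =
        (if h : (i : ℕ) + 1 < K then w (⟨i + 1, h⟩, a) else 0) - X * w (i, a) := fun i a => by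
      have hterm : ∀ p : Fin K × Fin n, (kron F K n)ᵀ (i.succ, a) p * w p =
          (if p.1.castSucc = i.succ ∧ p.2 = a then w p else 0) -
            X * (if p = (i, a) then w p else 0) := fun p => by
        obtain ⟨j, b⟩ := p
        simp only [kron, pencil, selInit, selTail, transpose_apply, of_apply, Matrix.neg_apply,
          Prod.mk.injEq, Fin.succ_inj]
        split_ifs <;> simp <;> ring
      simp only [Matrix.mulVec, dotProduct, hterm, Finset.sum_sub_distrib, ← Finset.mul_sum]
      congr 1
      · split_ifs with h
        · rw [Finset.sum_eq_single (⟨i + 1, h⟩, a)]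
          · rw [if_pos]
            simp [Fin.ext_iff]
          · rintro ⟨j, b⟩ - hne
            rw [if_neg]
            rintro ⟨h1, h2⟩
            refine hne (Prod.ext (Fin.ext ?_) h2)
            simpa [Fin.ext_iff] using h1
          · simp
        · refine Finset.sum_eq_zero fun p _ => if_neg ?_
          rintro ⟨h1, -⟩
          have h2 : (p.1 : ℕ) = i + 1 := by simpa [Fin.ext_iff] using h1
          have := p.1.isLt
          omega
      · simp
    have hcoeff : ∀ (t : ℕ) (i : Fin K) (a : Fin n), K - (i : ℕ) ≤ t → ∀ e, polyVecDeg y < e →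
        (w (i, a)).coeff e = 0 := by
      intro t
      induction t with
      | zero => intro i; have := i.isLt; omega
      | succ t ih =>
        intro i a hi e he
        have h := congrArg (fun f => (f (i.succ, a)).coeff (e + 1)) hnull
        simp only [Pi.add_apply, hkron, coeff_add, coeff_sub, coeff_X_mul, Pi.zero_apply,
          coeff_zero] at h
        rw [coeff_eq_zero_of_natDegree_lt ((hAdeg _).trans_lt (by omega))] at h
        split_ifs at h with hlt
        · rw [ih ⟨i + 1, hlt⟩ a (by simp only; omega) (e + 1) (by omega)] at h
          simpa using h
        · simpa using h
    rw [hz]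
    refine le_antisymm (polyVecDeg_le ?_) (polyVecDeg_le fun i => ?_)
    · rintro (i | ⟨i, a⟩)
      · exact natDegree_le_polyVecDeg y i
      · exact natDegree_le_iff_coeff_eq_zero.2 fun e he => hcoeff _ i a le_rfl e he
    · exact natDegree_le_polyVecDeg (Sum.elim y w) (Sum.inl i)
/-! ### Coefficients of the product with `Λ ⊗ I` -/

theorem mul_selInit_apply {K n : ℕ} {κ : Type*} (M : Matrix κ (Fin K × Fin n) F)
    (r : κ) (q : Fin (K + 1) × Fin n) :
    (M * selInit F K n) r q = if h : (q.1 : ℕ) < K then M r (⟨q.1, h⟩, q.2) else 0 := by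
  simp only [Matrix.mul_apply, selInit, of_apply, mul_ite, mul_one, mul_zero]
  split_ifs with h
  · rw [Finset.sum_eq_single (⟨q.1, h⟩, q.2)]
    · rw [if_pos]; rfl
    · intro p _ hne
      rw [if_neg]
      rintro rfl
      exact hne rfl
    · simp
  · refine Finset.sum_eq_zero fun p _ => if_neg ?_
    rintro rfl
    exact h p.1.isLt

theorem mul_selTail_apply {K n : ℕ} {κ : Type*} (M : Matrix κ (Fin K × Fin n) F)
    (r : κ) (q : Fin (K + 1) × Fin n) :
    (M * selTail F K n) r q = if h : 0 < (q.1 : ℕ) then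
      M r (⟨(q.1 : ℕ) - 1, by have := q.1.isLt; omega⟩, q.2) else 0 := by
  simp only [Matrix.mul_apply, selTail, of_apply, mul_ite, mul_one, mul_zero]
  split_ifs with h
  · rw [Finset.sum_eq_single (⟨(q.1 : ℕ) - 1, by have := q.1.isLt; omega⟩, q.2)]
    · rw [if_pos]
      refine Prod.ext (Fin.ext ?_) rfl
      simp only [Fin.val_succ]
      omega
    · intro p _ hne
      rw [if_neg]
      rintro rfl
      exact hne (Prod.ext (Fin.ext (by simp)) rfl)
    · simp
  · refine Finset.sum_eq_zero fun p _ => if_neg ?_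
    rintro rfl
    simp at h

/-- The column shifted sum of the coefficients of a pencil: the block row of coefficients of
its product with `Λ ⊗ I`, highest degree first. -/
def shiftSum {ρ : Type*} {K n : ℕ} (Xc Yc : Matrix ρ (Fin (K + 1) × Fin n) F) :
    Matrix ρ (Fin (K + 2) × Fin n) F :=
  Matrix.of fun r q =>
    (if h : (q.1 : ℕ) < K + 1 then Xc r (⟨q.1, h⟩, q.2) else 0) +
    (if h : 0 < (q.1 : ℕ) then
      Yc r (⟨(q.1 : ℕ) - 1, by have := q.1.isLt; omega⟩, q.2) else 0)

theorem shiftSum_add {ρ : Type*} {K n : ℕ} (X₁ X₂ Y₁ Y₂ : Matrix ρ (Fin (K + 1) × Fin n) F) :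
    shiftSum (X₁ + X₂) (Y₁ + Y₂) = shiftSum X₁ Y₁ + shiftSum X₂ Y₂ := by
  ext1 r q
  simp only [shiftSum, of_apply, Matrix.add_apply]
  split_ifs <;> ring

theorem shiftSum_smul {ρ : Type*} {K n : ℕ} (a : F) (Xc Yc : Matrix ρ (Fin (K + 1) × Fin n) F) :
    shiftSum (a • Xc) (a • Yc) = a • shiftSum Xc Yc := by
  ext1 r q
  simp only [shiftSum, of_apply, Matrix.smul_apply, smul_eq_mul]
  split_ifs <;> ring

/-- The coefficients of `(λ X + Y)(Λ ⊗ I)`. -/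
def coeffFam {K m n : ℕ} (Xc Yc : Matrix (Fin m) (Fin (K + 1) × Fin n) F) :
    Fin (K + 1 + 1) → Matrix (Fin m) (Fin n) F :=
  fun i => Matrix.of fun r c => shiftSum Xc Yc r (i.rev, c)

theorem pencil_mul_Lam {K m n : ℕ} (Xc Yc : Matrix (Fin m) (Fin (K + 1) × Fin n) F) :
    pencil Xc Yc * Lam F (K + 1) n = matPoly (coeffFam Xc Yc) := by
  ext1 r c
  have hl : (pencil Xc Yc * Lam F (K + 1) n) r c = ∑ j : Fin (K + 1),
      (C (Xc r (j, c)) * X ^ (K + 1 - (j : ℕ)) + C (Yc r (j, c)) * X ^ (K - (j : ℕ))) := by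
    simp only [Matrix.mul_apply, Fintype.sum_prod_type, Lam, pencil, of_apply, mul_ite, mul_zero,
      Finset.sum_ite_eq', Finset.mem_univ, if_true]
    refine Finset.sum_congr rfl fun j _ => ?_
    have hj : K + 1 - (j : ℕ) = K - j + 1 := by have := j.isLt; omega
    rw [hj, Nat.add_sub_cancel]
    ring
  have hr : matPoly (coeffFam Xc Yc) r c =
      ∑ i : Fin (K + 2), C (shiftSum Xc Yc r (i, c)) * X ^ (K + 1 - (i : ℕ)) := by
    simp only [matPoly, coeffFam, of_apply]
    rw [← Equiv.sum_comp Fin.revPerm]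
    refine Finset.sum_congr rfl fun i _ => ?_
    simp only [Fin.revPerm_apply, Fin.rev_rev, Fin.val_rev]
    congr 2
    omega
  rw [hl, hr]
  simp only [shiftSum, of_apply, C_add, add_mul, Finset.sum_add_distrib]
  congr 1
  · conv_rhs => rw [Fin.sum_univ_castSucc]
    simp [Fin.is_le]
  · conv_rhs => rw [Fin.sum_univ_succ]
    simp

theorem revMat_matPoly {k m n : ℕ} (A : Fin (k + 1) → Matrix (Fin m) (Fin n) F) :
    revMat k (matPoly A) = matPoly fun i => A i.rev := by
  ext1 r c
  let φ : F[X] →+ F[X] :=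
    { toFun := reflect k, map_zero' := reflect_zero, map_add' := fun f g => reflect_add f g k }
  have h : revMat k (matPoly A) r c =
      ∑ i : Fin (k + 1), φ (C (A i r c) * X ^ (i : ℕ)) := by
    rw [← map_sum]
    rfl
  rw [h]
  simp only [matPoly, of_apply]
  rw [← Equiv.sum_comp Fin.revPerm]
  refine Finset.sum_congr rfl fun i _ => ?_
  have hφ : ∀ p, φ p = reflect k p := fun _ => rfl
  rw [hφ, reflect_C_mul_X_pow, Polynomial.revAt_le (by have := i.isLt; simp)]
  simp only [Fin.revPerm_apply, Fin.val_rev]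
  congr 2
  have := i.isLt
  omega

/-- The permutation matrix reversing the order of the blocks. -/
def blockFlip (F : Type*) [RCLike F] (K n : ℕ) : Matrix (Fin K × Fin n) (Fin K × Fin n) F :=
  Matrix.of fun p q => if (p.1.rev, p.2) = q then 1 else 0

theorem blockFlip_mul_apply {K n : ℕ} {κ : Type*} (M : Matrix (Fin K × Fin n) κ F)
    (p : Fin K × Fin n) (c : κ) : (blockFlip F K n * M) p c = M (p.1.rev, p.2) c := by
  simp [blockFlip, Matrix.mul_apply]

theorem mul_blockFlip_apply {K n : ℕ} {κ : Type*} (M : Matrix κ (Fin K × Fin n) F)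
    (r : κ) (q : Fin K × Fin n) : (M * blockFlip F K n) r q = M r (q.1.rev, q.2) := by
  simp only [blockFlip, Matrix.mul_apply, of_apply, mul_ite, mul_one, mul_zero]
  rw [Finset.sum_eq_single (q.1.rev, q.2)]
  · simp
  · rintro p - hne
    rw [if_neg]
    rintro rfl
    simp at hne
  · simp

theorem blockFlip_mul_self (K n : ℕ) : blockFlip F K n * blockFlip F K n = 1 := by
  ext1 p q
  rw [blockFlip_mul_apply]
  simp [blockFlip, Matrix.one_apply]

theorem blockFlip_mul_selInit_mul_blockFlip (K n : ℕ) :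
    blockFlip F K n * selInit F K n * blockFlip F (K + 1) n = selTail F K n := by
  ext1 p q
  rw [mul_blockFlip_apply, blockFlip_mul_apply]
  simp only [selInit, selTail, of_apply, Prod.ext_iff, ← Fin.rev_succ, Fin.rev_inj]

theorem blockFlip_mul_selTail_mul_blockFlip (K n : ℕ) :
    blockFlip F K n * selTail F K n * blockFlip F (K + 1) n = selInit F K n := by
  ext1 p q
  rw [mul_blockFlip_apply, blockFlip_mul_apply]
  simp only [selInit, selTail, of_apply, Prod.ext_iff, ← Fin.rev_castSucc, Fin.rev_inj]

theorem coeffFam_blockFlip {K m n : ℕ} (Xc Yc : Matrix (Fin m) (Fin (K + 1) × Fin n) F) :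
    coeffFam (Yc * blockFlip F (K + 1) n) (Xc * blockFlip F (K + 1) n) =
      fun i => coeffFam Xc Yc i.rev := by
  funext i
  ext1 r c
  simp only [coeffFam, shiftSum, of_apply, mul_blockFlip_apply, Fin.rev_rev, Fin.val_rev]
  rw [add_comm]
  have := i.isLt
  congr 1
  · by_cases h : 0 < K + 1 + 1 - ((i : ℕ) + 1)
    · rw [dif_pos h, dif_pos (by omega)]
      congr 2
      ext
      simp only [Fin.val_rev]
      omega
    · rw [dif_neg h, dif_neg (by omega)]
  · by_cases h : 0 < (i : ℕ)
    · rw [dif_pos h, dif_pos (by omega)]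
      congr 2
      ext
      simp only [Fin.val_rev]
      omega
    · rw [dif_neg h, dif_neg (by omega)]

/-! ### Pencils strictly equivalent to a block pencil -/

section StrictEquivalence

variable {K m n : ℕ}
  {S S' : Matrix (Fin m ⊕ (Fin K × Fin n)) (Fin m ⊕ (Fin K × Fin n)) F}
  {T T' : Matrix (Fin (K + 1) × Fin n) (Fin (K + 1) × Fin n) F}

theorem pencil_strictEquiv (Xc Yc : Matrix (Fin m) (Fin (K + 1) × Fin n) F) :
    pencil (S * fromRows Xc (-selTail F K n) * T) (S * fromRows Yc (selInit F K n) * T) =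
      S.map C * corePencil (pencil Xc Yc) * T.map C := by
  rw [pencil_mul_mul, pencil_fromRows]
  rfl

theorem isLin_strictEquiv (hS : S' * S = 1) (hT : T * T' = 1)
    (Xc Yc : Matrix (Fin m) (Fin (K + 1) × Fin n) F) :
    IsLin (K * n) (matPoly (coeffFam Xc Yc))
      (pencil (S * fromRows Xc (-selTail F K n) * T)
        (S * fromRows Yc (selInit F K n) * T)) := by
  rw [pencil_strictEquiv, ← pencil_mul_Lam]
  exact isLin_corePencil _ hS hT

theorem isStrongLin_strictEquiv (hS : S' * S = 1) (hT : T * T' = 1)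
    (Xc Yc : Matrix (Fin m) (Fin (K + 1) × Fin n) F) :
    IsStrongLin (K * n) (coeffFam Xc Yc)
      (pencil (S * fromRows Xc (-selTail F K n) * T)
        (S * fromRows Yc (selInit F K n) * T)) := by
  refine ⟨isLin_strictEquiv hS hT Xc Yc, ?_⟩
  rw [revMat_pencil, revMat_matPoly, ← coeffFam_blockFlip]
  let B : Matrix (Fin m ⊕ (Fin K × Fin n)) (Fin m ⊕ (Fin K × Fin n)) F :=
    fromBlocks 1 0 0 (-blockFlip F K n)
  have hB : B * B = 1 := by
    simp [B, fromBlocks_multiply, blockFlip_mul_self]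
  have hflip : ∀ (Z : Matrix (Fin m) (Fin (K + 1) × Fin n) F) (V V' : Matrix (Fin K × Fin n)
      (Fin (K + 1) × Fin n) F), blockFlip F K n * V * blockFlip F (K + 1) n = -V' →
      fromRows Z V' = B * fromRows (Z * blockFlip F (K + 1) n) V * blockFlip F (K + 1) n := by
    intro Z V V' hV
    rw [fromBlocks_mul_fromRows, fromRows_mul]
    simp only [Matrix.one_mul, Matrix.zero_mul, add_zero, zero_add, Matrix.neg_mul, hV, neg_neg,
      Matrix.mul_assoc Z, blockFlip_mul_self, Matrix.mul_one]
  rw [hflip Yc (-selTail F K n) (selInit F K n) (by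
      rw [Matrix.mul_neg, Matrix.neg_mul, blockFlip_mul_selTail_mul_blockFlip]),
    hflip Xc (selInit F K n) (-selTail F K n) (by
      rw [blockFlip_mul_selInit_mul_blockFlip, neg_neg])]
  have h := isLin_strictEquiv (S := S * B) (S' := B * S') (T := blockFlip F (K + 1) n * T)
    (T' := T' * blockFlip F (K + 1) n) ?_ ?_ (Yc * blockFlip F (K + 1) n)
    (Xc * blockFlip F (K + 1) n)
  · simpa only [Matrix.mul_assoc] using h
  · rw [Matrix.mul_assoc, ← Matrix.mul_assoc S', hS, Matrix.one_mul, hB]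
  · rw [Matrix.mul_assoc, ← Matrix.mul_assoc T, hT, Matrix.one_mul, blockFlip_mul_self]

theorem hasMinIndices_Nr_strictEquiv (hS : S' * S = 1) (hT : T * T' = 1)
    (Xc Yc : Matrix (Fin m) (Fin (K + 1) × Fin n) F) {d : ℕ} (ε : Fin d → ℕ) :
    HasMinIndices (Nr (matPoly (coeffFam Xc Yc))) ε ↔
      HasMinIndices (Nr (pencil (S * fromRows Xc (-selTail F K n) * T)
        (S * fromRows Yc (selInit F K n) * T))) fun i => ε i + K := by
  rw [pencil_strictEquiv, ← pencil_mul_Lam, ← hasMinIndices_mul_mul_iff hS hT]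
  exact hasMinIndices_Nr_corePencil _ ε

theorem hasMinIndices_Nl_strictEquiv (hS : S' * S = 1) (hT : T * T' = 1)
    (Xc Yc : Matrix (Fin m) (Fin (K + 1) × Fin n) F) {d : ℕ} (δ : Fin d → ℕ) :
    HasMinIndices (Nl (matPoly (coeffFam Xc Yc))) δ ↔
      HasMinIndices (Nl (pencil (S * fromRows Xc (-selTail F K n) * T)
        (S * fromRows Yc (selInit F K n) * T))) δ := by
  have hS' : Sᵀ * S'ᵀ = 1 := by rw [← transpose_mul, hS, transpose_one]
  have hT' : T'ᵀ * Tᵀ = 1 := by rw [← transpose_mul, hT, transpose_one]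
  rw [pencil_strictEquiv, ← pencil_mul_Lam, hasMinIndices_Nl_corePencil, Nl, Nl, transpose_mul,
    transpose_mul, ← transpose_map, ← transpose_map, ← Matrix.mul_assoc]
  exact hasMinIndices_mul_mul_iff hT' hS' _ δ

end StrictEquivalence

/-! ### Frobenius norm estimates -/

section Frobenius

open scoped Matrix.Norms.Frobenius

variable {ρ ρ' γ γ' : Type*} [Fintype ρ] [Fintype ρ'] [Fintype γ] [Fintype γ']

theorem frobSq_eq_norm_sq (M : Matrix ρ γ F) : frobSq M = ‖M‖ ^ 2 := by
  have h : (0 : ℝ) ≤ ∑ i, ∑ j, ‖M i j‖ ^ 2 := by positivity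
  rw [frobenius_norm_def, ← Real.sqrt_eq_rpow]
  simp only [Real.rpow_two]
  rw [Real.sq_sqrt h, frobSq]

theorem frobSq_nonneg (M : Matrix ρ γ F) : 0 ≤ frobSq M := by
  rw [frobSq_eq_norm_sq]
  positivity

theorem frobSq_fromRows (M : Matrix ρ γ F) (N : Matrix ρ' γ F) :
    frobSq (fromRows M N) = frobSq M + frobSq N := by
  simp [frobSq]

theorem penFrob_eq_norm (Xc Yc : Matrix ρ γ F) : penFrob Xc Yc = ‖fromRows Xc Yc‖ := by
  rw [penFrob, ← frobSq_fromRows, frobSq_eq_norm_sq, Real.sqrt_sq (norm_nonneg _)]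

theorem penFrob_sq (Xc Yc : Matrix ρ γ F) : penFrob Xc Yc ^ 2 = frobSq Xc + frobSq Yc :=
  Real.sq_sqrt (add_nonneg (frobSq_nonneg _) (frobSq_nonneg _))

theorem penFrob_nonneg (Xc Yc : Matrix ρ γ F) : 0 ≤ penFrob Xc Yc :=
  Real.sqrt_nonneg _

theorem penFrob_add_le (X₁ X₂ Y₁ Y₂ : Matrix ρ γ F) :
    penFrob (X₁ + X₂) (Y₁ + Y₂) ≤ penFrob X₁ Y₁ + penFrob X₂ Y₂ := by
  simp only [penFrob_eq_norm]
  refine le_trans (le_of_eq (congrArg _ ?_)) (norm_add_le _ _)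
  ext1 (i | i) j <;> rfl

theorem penFrob_mul_le (Xc Yc : Matrix ρ γ F) (N : Matrix γ γ' F) :
    penFrob (Xc * N) (Yc * N) ≤ penFrob Xc Yc * ‖N‖ := by
  simp only [penFrob_eq_norm, ← fromRows_mul]
  exact frobenius_norm_mul _ _

theorem norm_le_penFrob_right (Xc Yc : Matrix ρ γ F) : ‖Yc‖ ≤ penFrob Xc Yc := by
  refine Real.le_sqrt_of_sq_le ?_
  rw [← frobSq_eq_norm_sq]
  linarith [frobSq_nonneg Xc]

theorem frobSq_submatrix_le (M : Matrix ρ γ F) {f : ρ' → ρ} {g : γ' → γ}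
    (hf : Function.Injective f) (hg : Function.Injective g) :
    frobSq (M.submatrix f g) ≤ frobSq M := by
  simp only [frobSq, submatrix_apply]
  calc ∑ i, ∑ j, ‖M (f i) (g j)‖ ^ 2 ≤ ∑ i, ∑ j, ‖M (f i) j‖ ^ 2 :=
        Finset.sum_le_sum fun i _ => by
          have := Finset.sum_map Finset.univ ⟨g, hg⟩ fun j => ‖M (f i) j‖ ^ 2
          simp only [Function.Embedding.coeFn_mk] at this
          rw [← this]
          exact Finset.sum_le_univ_sum_of_nonneg fun _ => by positivity
    _ ≤ ∑ i, ∑ j, ‖M i j‖ ^ 2 := by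
          have := Finset.sum_map Finset.univ ⟨f, hf⟩ fun i => ∑ j, ‖M i j‖ ^ 2
          simp only [Function.Embedding.coeFn_mk] at this
          rw [← this]
          exact Finset.sum_le_univ_sum_of_nonneg fun _ => by positivity

theorem norm_submatrix_le (M : Matrix ρ γ F) {f : ρ' → ρ} {g : γ' → γ}
    (hf : Function.Injective f) (hg : Function.Injective g) : ‖M.submatrix f g‖ ≤ ‖M‖ := by
  refine le_of_sq_le_sq ?_ (norm_nonneg _)
  simpa only [frobSq_eq_norm_sq] using frobSq_submatrix_le M hf hg

theorem isUnit_one_add_of_norm_lt_one [DecidableEq ρ] {M : Matrix ρ ρ F} (hM : ‖M‖ < 1) :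
    IsUnit (1 + M) := by
  rw [← sub_neg_eq_add]
  have : CompleteSpace (Matrix ρ ρ F) := FiniteDimensional.complete F _
  exact isUnit_one_sub_of_norm_lt_one (by rwa [norm_neg])

theorem frobSq_shiftSum_le {K n : ℕ} (Xc Yc : Matrix ρ (Fin (K + 1) × Fin n) F) :
    frobSq (shiftSum Xc Yc) ≤ 2 * (frobSq Xc + frobSq Yc) := by
  simp only [frobSq, ← Finset.sum_add_distrib, Finset.mul_sum]
  refine Finset.sum_le_sum fun r _ => ?_
  rw [← Finset.mul_sum, Finset.sum_add_distrib]
  have hX : ∑ q, ‖Xc r q‖ ^ 2 = ∑ q : Fin (K + 2) × Fin n,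
      ‖if h : (q.1 : ℕ) < K + 1 then Xc r (⟨q.1, h⟩, q.2) else 0‖ ^ 2 := by
    simp only [Fintype.sum_prod_type]
    conv_rhs => rw [Fin.sum_univ_castSucc]
    simp [Fin.is_le]
  have hY : ∑ q, ‖Yc r q‖ ^ 2 = ∑ q : Fin (K + 2) × Fin n,
      ‖if h : 0 < (q.1 : ℕ) then
        Yc r (⟨(q.1 : ℕ) - 1, by have := q.1.isLt; omega⟩, q.2) else 0‖ ^ 2 := by
    simp only [Fintype.sum_prod_type]
    conv_rhs => rw [Fin.sum_univ_succ]
    simp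
  rw [hX, hY, ← Finset.sum_add_distrib, Finset.mul_sum]
  refine Finset.sum_le_sum fun q _ => ?_
  simp only [shiftSum, of_apply]
  refine (pow_le_pow_left₀ (norm_nonneg _) (norm_add_le _ _) 2).trans ?_
  exact add_sq_le

theorem norm_shiftSum_le {K n : ℕ} (Xc Yc : Matrix ρ (Fin (K + 1) × Fin n) F) :
    ‖shiftSum Xc Yc‖ ≤ √2 * penFrob Xc Yc := by
  rw [penFrob, ← Real.sqrt_mul (by norm_num)]
  refine Real.le_sqrt_of_sq_le ?_
  rw [← frobSq_eq_norm_sq]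
  exact frobSq_shiftSum_le Xc Yc

theorem famFrob_coeffFam {K m n : ℕ} (Xc Yc : Matrix (Fin m) (Fin (K + 1) × Fin n) F) :
    famFrob (coeffFam Xc Yc) = ‖shiftSum Xc Yc‖ := by
  rw [famFrob, ← Real.sqrt_sq (norm_nonneg (shiftSum Xc Yc)), ← frobSq_eq_norm_sq]
  congr 1
  simp only [frobSq, coeffFam, of_apply]
  rw [Finset.sum_comm]
  refine Finset.sum_congr rfl fun r _ => ?_
  rw [Fintype.sum_prod_type, ← Equiv.sum_comp Fin.revPerm]
  simp

end Frobenius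

/-! ### Singular values -/

section SingularValues

variable {ρ γ κ : Type*} [Fintype ρ] [Fintype γ] [Fintype κ]

theorem vecNormSq_nonneg (x : γ → F) : 0 ≤ vecNormSq x :=
  Finset.sum_nonneg fun _ _ => by positivity

theorem vecNormSq_smul (a : F) (x : γ → F) : vecNormSq (a • x) = ‖a‖ ^ 2 * vecNormSq x := by
  simp [vecNormSq, Finset.mul_sum, mul_pow]

theorem frobSq_eq_sum_vecNormSq (N : Matrix γ κ F) : frobSq N = ∑ c, vecNormSq (N.col c) := by
  rw [frobSq, Finset.sum_comm]
  rfl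

theorem exists_vecNormSq_eq_one {x : γ → F} (hx : vecNormSq x ≠ 0) :
    ∃ a : F, ‖a‖ ^ 2 * vecNormSq x = 1 := by
  refine ⟨((√(vecNormSq x))⁻¹ : ℝ), ?_⟩
  rw [RCLike.norm_ofReal, sq_abs, inv_pow, Real.sq_sqrt (vecNormSq_nonneg x), inv_mul_cancel₀ hx]

theorem sigmaMin_nonneg (M : Matrix ρ γ F) : 0 ≤ sigmaMin M := by
  rw [sigmaMin]
  split_ifs
  all_goals
    refine Real.sInf_nonneg ?_
    rintro r ⟨x, -, rfl⟩
    exact Real.sqrt_nonneg _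

theorem sigmaMin_sq_mul_vecNormSq_le (M : Matrix ρ ρ F) (x : ρ → F) :
    sigmaMin M ^ 2 * vecNormSq x ≤ vecNormSq (M *ᵥ x) := by
  by_cases hx : vecNormSq x = 0
  · rw [hx, mul_zero]
    exact vecNormSq_nonneg _
  obtain ⟨a, ha⟩ := exists_vecNormSq_eq_one hx
  have h : sigmaMin M ≤ √(vecNormSq (M *ᵥ (a • x))) := by
    rw [sigmaMin, if_pos le_rfl]
    refine csInf_le ⟨0, ?_⟩ ⟨a • x, by rw [vecNormSq_smul, ha], rfl⟩
    rintro r ⟨y, -, rfl⟩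
    exact Real.sqrt_nonneg _
  have h2 := pow_le_pow_left₀ (sigmaMin_nonneg M) h 2
  rw [Real.sq_sqrt (vecNormSq_nonneg _), mulVec_smul, vecNormSq_smul] at h2
  calc sigmaMin M ^ 2 * vecNormSq x ≤ ‖a‖ ^ 2 * vecNormSq (M *ᵥ x) * vecNormSq x :=
        mul_le_mul_of_nonneg_right h2 (vecNormSq_nonneg x)
    _ = ‖a‖ ^ 2 * vecNormSq x * vecNormSq (M *ᵥ x) := by ring
    _ = vecNormSq (M *ᵥ x) := by rw [ha, one_mul]

theorem sigmaMin_sq_mul_frobSq_le (M : Matrix ρ ρ F) (N : Matrix ρ κ F) :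
    sigmaMin M ^ 2 * frobSq N ≤ frobSq (M * N) := by
  simp only [frobSq_eq_sum_vecNormSq, Finset.mul_sum]
  exact Finset.sum_le_sum fun c _ => sigmaMin_sq_mul_vecNormSq_le M (N.col c)

theorem sigmaMin_eq_zero_of_isEmpty [IsEmpty ρ] (M : Matrix ρ ρ F) : sigmaMin M = 0 := by
  rw [sigmaMin, if_pos le_rfl]
  convert Real.sInf_empty
  refine Set.eq_empty_of_forall_notMem ?_
  rintro r ⟨x, hx, -⟩
  simp [vecNormSq] at hx

theorem vecNormSq_mulVec_le (M : Matrix ρ γ F) (x : γ → F) :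
    vecNormSq (M *ᵥ x) ≤ frobSq M * vecNormSq x := by
  open scoped Matrix.Norms.Frobenius in
  have h := frobenius_norm_mul M (replicateCol Unit x)
  have h2 := pow_le_pow_left₀ (norm_nonneg _) h 2
  rw [mul_pow, ← frobSq_eq_norm_sq, ← frobSq_eq_norm_sq, ← frobSq_eq_norm_sq] at h2
  simp only [frobSq_eq_sum_vecNormSq (replicateCol _ _), frobSq_eq_sum_vecNormSq (_ * _),
    Finset.univ_unique, Finset.sum_singleton] at h2
  exact h2

theorem norm2_nonneg (M : Matrix ρ γ F) : 0 ≤ norm2 M := by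
  refine Real.sSup_nonneg ?_
  rintro r ⟨x, -, rfl⟩
  exact Real.sqrt_nonneg _

theorem vecNormSq_mulVec_le_norm2 (M : Matrix ρ γ F) (x : γ → F) :
    vecNormSq (M *ᵥ x) ≤ norm2 M ^ 2 * vecNormSq x := by
  by_cases hx : vecNormSq x = 0
  · have := vecNormSq_mulVec_le M x
    rwa [hx, mul_zero] at this ⊢
  obtain ⟨a, ha⟩ := exists_vecNormSq_eq_one hx
  have h : √(vecNormSq (M *ᵥ (a • x))) ≤ norm2 M := by
    refine le_csSup ⟨√(frobSq M), ?_⟩ ⟨a • x, by rw [vecNormSq_smul, ha], rfl⟩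
    rintro r ⟨y, hy, rfl⟩
    have := vecNormSq_mulVec_le M y
    rw [hy, mul_one] at this
    exact Real.sqrt_le_sqrt this
  have h2 := pow_le_pow_left₀ (Real.sqrt_nonneg _) h 2
  rw [Real.sq_sqrt (vecNormSq_nonneg _), mulVec_smul, vecNormSq_smul] at h2
  calc vecNormSq (M *ᵥ x) = ‖a‖ ^ 2 * vecNormSq (M *ᵥ x) * vecNormSq x := by
        rw [mul_right_comm, ha, one_mul]
    _ ≤ norm2 M ^ 2 * vecNormSq x := mul_le_mul_of_nonneg_right h2 (vecNormSq_nonneg x)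

theorem frobSq_mul_le_norm2 (M : Matrix ρ γ F) (N : Matrix γ κ F) :
    frobSq (M * N) ≤ norm2 M ^ 2 * frobSq N := by
  simp only [frobSq_eq_sum_vecNormSq, Finset.mul_sum]
  exact Finset.sum_le_sum fun c _ => vecNormSq_mulVec_le_norm2 M (N.col c)

theorem penFrob_mul_le_norm2 (M : Matrix ρ γ F) (Xc Yc : Matrix γ κ F) :
    penFrob (M * Xc) (M * Yc) ≤ norm2 M * penFrob Xc Yc := by
  refine le_of_sq_le_sq ?_ (mul_nonneg (norm2_nonneg M) (penFrob_nonneg _ _))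
  rw [mul_pow, penFrob_sq, penFrob_sq, mul_add]
  exact add_le_add (frobSq_mul_le_norm2 M Xc) (frobSq_mul_le_norm2 M Yc)

theorem sigmaMin_mul_penFrob_le (M : Matrix ρ ρ F) (Xc Yc : Matrix ρ κ F) :
    sigmaMin M * penFrob Xc Yc ≤ penFrob (M * Xc) (M * Yc) := by
  refine le_of_sq_le_sq ?_ (penFrob_nonneg _ _)
  rw [mul_pow, penFrob_sq, penFrob_sq, mul_add]
  exact add_le_add (sigmaMin_sq_mul_frobSq_le M Xc) (sigmaMin_sq_mul_frobSq_le M Yc)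

end SingularValues

/-! ### A generalized Sylvester operator -/

theorem sum_sq_le_of_chain {X : Type*} [Fintype X] {f g : X → ℝ} (hf : ∀ x, 0 ≤ f x)
    {level : X → ℕ} {pred : X → X} {K : ℕ} (hlevel : ∀ x, level x ≤ K)
    (hzero : ∀ x, level x = 0 → f x = 0) (hone : ∀ x, level x = 1 → f x ≤ g x)
    (hstep : ∀ x j, level x = j + 2 → level (pred x) = j + 1 ∧ f x ≤ f (pred x) + g x)
    (hinj : ∀ x y j, level x = j + 2 → level y = j + 2 → pred x = pred y → x = y) :
    ∑ x, f x ^ 2 ≤ (K : ℝ) * (K + 1) / 2 * ∑ x, g x ^ 2 := by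
  classical
  have hlev : ∀ j : ℕ, ∑ x with level x = j + 1, f x ^ 2 ≤
      (j + 1 : ℝ) * ∑ x with level x ≤ j + 1, g x ^ 2 := by
    intro j
    induction j with
    | zero =>
      simp only [Nat.cast_zero, zero_add, one_mul]
      calc ∑ x with level x = 1, f x ^ 2 ≤ ∑ x with level x = 1, g x ^ 2 :=
            Finset.sum_le_sum fun x hx =>
              pow_le_pow_left₀ (hf x) (hone x (Finset.mem_filter.1 hx).2) 2
        _ ≤ ∑ x with level x ≤ 1, g x ^ 2 :=
            Finset.sum_le_sum_of_subset_of_nonneg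
              (Finset.monotone_filter_right _ fun x _ h => h.le) fun _ _ _ => by positivity
    | succ j ih =>
      have hsplit : ∑ x with level x ≤ j + 1 + 1, g x ^ 2 =
          ∑ x with level x ≤ j + 1, g x ^ 2 + ∑ x with level x = j + 2, g x ^ 2 := by
        rw [← Finset.sum_union]
        · congr 1
          ext x
          simp only [Finset.mem_filter, Finset.mem_univ, true_and, Finset.mem_union]
          omega
        · rw [Finset.disjoint_filter]
          intro x _ h1 h2
          omega
      have hpred : ∑ x with level x = j + 2, f (pred x) ^ 2 ≤
          ∑ x with level x = j + 1, f x ^ 2 := by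
        have himg := Finset.sum_image (s := Finset.univ.filter fun x => level x = j + 2)
          (f := fun x => f x ^ 2) (g := pred) (by
            intro x hx y hy hxy
            exact hinj x y j (by simpa using hx) (by simpa using hy) hxy)
        rw [← himg]
        refine Finset.sum_le_sum_of_subset_of_nonneg ?_ fun _ _ _ => by positivity
        intro y hy
        obtain ⟨x, hx, rfl⟩ := Finset.mem_image.1 hy
        exact Finset.mem_filter.2 ⟨Finset.mem_univ _, (hstep x j (Finset.mem_filter.1 hx).2).1⟩
      have hpoint : (j + 1 : ℝ) * ∑ x with level x = j + 2, f x ^ 2 ≤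
          (j + 2) * ∑ x with level x = j + 2, f (pred x) ^ 2 +
            (j + 1) * (j + 2) * ∑ x with level x = j + 2, g x ^ 2 := by
        simp only [Finset.mul_sum, ← Finset.sum_add_distrib]
        refine Finset.sum_le_sum fun x hx => ?_
        have h := pow_le_pow_left₀ (hf x) (hstep x j (Finset.mem_filter.1 hx).2).2 2
        have hj : (0 : ℝ) ≤ j := j.cast_nonneg
        nlinarith [sq_nonneg (f (pred x) - (j + 1) * g x),
          mul_le_mul_of_nonneg_left h (by positivity : (0 : ℝ) ≤ j + 1)]
      rw [hsplit]
      have hj : (0 : ℝ) < j + 1 := by positivity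
      refine le_of_mul_le_mul_left ?_ hj
      push_cast
      calc (j + 1 : ℝ) * ∑ x with level x = j + 2, f x ^ 2
          ≤ (j + 2) * ((j + 1) * ∑ x with level x ≤ j + 1, g x ^ 2) +
            (j + 1) * (j + 2) * ∑ x with level x = j + 2, g x ^ 2 := by
              refine hpoint.trans ?_
              gcongr
              exact hpred.trans ih
        _ = _ := by ring
  have hfib : ∑ x, f x ^ 2 = ∑ j ∈ Finset.range (K + 1), ∑ x with level x = j, f x ^ 2 :=
    (Finset.sum_fiberwise_of_maps_to
      (fun x _ => Finset.mem_range.2 (Nat.lt_succ_of_le (hlevel x))) _).symm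
  have hzero' : ∑ x with level x = 0, f x ^ 2 = 0 :=
    Finset.sum_eq_zero fun x hx => by rw [hzero x (Finset.mem_filter.1 hx).2]; norm_num
  rw [hfib, Finset.sum_range_succ', hzero', add_zero]
  calc ∑ j ∈ Finset.range K, ∑ x with level x = j + 1, f x ^ 2
      ≤ ∑ j ∈ Finset.range K, (j + 1 : ℝ) * ∑ x, g x ^ 2 :=
        Finset.sum_le_sum fun j _ => (hlev j).trans (by
          gcongr
          exact Finset.subset_univ _)
    _ = (K : ℝ) * (K + 1) / 2 * ∑ x, g x ^ 2 := by
        rw [← Finset.sum_mul]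
        congr 1
        clear hlevel hfib
        induction K with
        | zero => simp
        | succ K ih =>
          rw [Finset.sum_range_succ, ih]
          push_cast
          ring

theorem sum_option_elim_le {X Y : Type*} [Fintype X] [Fintype Y] (u : X → Option Y) {h : Y → ℝ}
    (hh : ∀ y, 0 ≤ h y) (hu : ∀ x x' y, u x = some y → u x' = some y → x = x') :
    ∑ x, (u x).elim 0 h ≤ ∑ y, h y := by
  classical
  have hx : ∀ x, (u x).elim 0 h = ∑ y, if u x = some y then h y else 0 := by
    intro x
    cases hux : u x <;> simp
  simp only [hx]
  rw [Finset.sum_comm]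
  refine Finset.sum_le_sum fun y _ => ?_
  by_cases hy : ∃ x, u x = some y
  · obtain ⟨x, hxy⟩ := hy
    rw [Finset.sum_eq_single x (fun x' _ hne => if_neg fun h' => hne (hu _ _ _ h' hxy))
      (by simp), if_pos hxy]
  · push Not at hy
    simp only [hy, if_false, Finset.sum_const_zero, hh]

/-- The action of the Kronecker pencil on constant matrices. -/
theorem shiftSum_sel_apply {K n : ℕ} (τ : Matrix (Fin (K + 1) × Fin n) (Fin (K + 1) × Fin n) F)
    (p : Fin K × Fin n) (q : Fin (K + 2) × Fin n) :
    shiftSum (-(selTail F K n * τ)) (selInit F K n * τ) p q =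
      (if h : (q.1 : ℕ) < K + 1 then -τ (p.1.succ, p.2) (⟨q.1, h⟩, q.2) else 0) +
      (if h : 0 < (q.1 : ℕ) then
        τ (p.1.castSucc, p.2) (⟨(q.1 : ℕ) - 1, by have := q.1.isLt; omega⟩, q.2) else 0) := by
  simp only [shiftSum, of_apply, Matrix.neg_apply, selTail_mul_apply, selInit_mul_apply]

theorem frobSq_le_frobSq_shiftSum {K n : ℕ}
    (τ : Matrix (Fin (K + 1) × Fin n) (Fin (K + 1) × Fin n) F)
    (hτ : ∀ a b, τ (0, a) (0, b) = 0) :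
    frobSq τ ≤ (K : ℝ) * (K + 1) / 2 *
      frobSq (shiftSum (-(selTail F K n * τ)) (selInit F K n * τ)) := by
  set S := shiftSum (-(selTail F K n * τ)) (selInit F K n * τ) with hS
  -- the entry of `S` governing the entry of `τ` at a position other than `(0, 0)`
  let gov : (Fin (K + 1) × Fin n) × (Fin (K + 1) × Fin n) →
      Option ((Fin K × Fin n) × (Fin (K + 2) × Fin n)) := fun x =>
    if h : (x.2.1 : ℕ) ≤ x.1.1 then
      if h0 : (x.1.1 : ℕ) = 0 then none
      else some ((⟨(x.1.1 : ℕ) - 1, by have := x.1.1.isLt; omega⟩, x.1.2),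
        (⟨x.2.1, by have := x.2.1.isLt; omega⟩, x.2.2))
    else some ((⟨x.1.1, by have := x.2.1.isLt; omega⟩, x.1.2),
      (⟨(x.2.1 : ℕ) + 1, by have := x.2.1.isLt; omega⟩, x.2.2))
  let g : (Fin (K + 1) × Fin n) × (Fin (K + 1) × Fin n) → ℝ := fun x =>
    (gov x).elim 0 fun y => ‖S y.1 y.2‖
  let level : (Fin (K + 1) × Fin n) × (Fin (K + 1) × Fin n) → ℕ := fun x =>
    if (x.2.1 : ℕ) < x.1.1 then x.2.1 + 1 else if (x.2.1 : ℕ) = x.1.1 then x.2.1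
    else K - x.2.1 + 1
  let pred : (Fin (K + 1) × Fin n) × (Fin (K + 1) × Fin n) →
      (Fin (K + 1) × Fin n) × (Fin (K + 1) × Fin n) := fun x =>
    if (x.2.1 : ℕ) ≤ x.1.1 then
      ((⟨(x.1.1 : ℕ) - 1, by have := x.1.1.isLt; omega⟩, x.1.2),
        (⟨(x.2.1 : ℕ) - 1, by have := x.2.1.isLt; omega⟩, x.2.2))
    else ((⟨min ((x.1.1 : ℕ) + 1) K, by omega⟩, x.1.2),
        (⟨min ((x.2.1 : ℕ) + 1) K, by omega⟩, x.2.2))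
  have hchain : ∑ x : (Fin (K + 1) × Fin n) × (Fin (K + 1) × Fin n), ‖τ x.1 x.2‖ ^ 2 ≤
      (K : ℝ) * (K + 1) / 2 * ∑ x, g x ^ 2 := by
    have hlow : ∀ (i j : ℕ) (hi : i < K + 1) (hj : j < K + 1) (a b : Fin n) (h1 : j ≤ i)
        (h0 : i ≠ 0), ‖τ (⟨i, hi⟩, a) (⟨j, hj⟩, b)‖ ≤ (if 0 < j then
          ‖τ (⟨i - 1, by omega⟩, a) (⟨j - 1, by omega⟩, b)‖ else 0) +
          g ((⟨i, hi⟩, a), (⟨j, hj⟩, b)) := by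
      intro i j hi hj a b h1 h0
      have hgov : g ((⟨i, hi⟩, a), (⟨j, hj⟩, b)) =
          ‖S (⟨i - 1, by omega⟩, a) (⟨j, by omega⟩, b)‖ := by
        simp [g, gov, h1, h0]
      have hsucc : (Fin.succ ⟨i - 1, by omega⟩ : Fin (K + 1)) = ⟨i, hi⟩ := by
        ext
        simp only [Fin.val_succ]
        omega
      rw [hgov, hS, shiftSum_sel_apply]
      simp only [hj, dite_true, hsucc, Fin.castSucc_mk]
      by_cases hj0 : 0 < j
      · simp only [hj0, dite_true, if_true]
        rw [neg_add_eq_sub, norm_sub_rev]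
        exact norm_le_norm_add_norm_sub' _ _
      · simp [hj0]
    have hupp : ∀ (i j : ℕ) (hi : i < K + 1) (hj : j < K + 1) (a b : Fin n) (h1 : i < j),
        ‖τ (⟨i, hi⟩, a) (⟨j, hj⟩, b)‖ ≤ (if h : j < K then
          ‖τ (⟨i + 1, by omega⟩, a) (⟨j + 1, by omega⟩, b)‖ else 0) +
          g ((⟨i, hi⟩, a), (⟨j, hj⟩, b)) := by
      intro i j hi hj a b h1
      have hgov : g ((⟨i, hi⟩, a), (⟨j, hj⟩, b)) =
          ‖S (⟨i, by omega⟩, a) (⟨j + 1, by omega⟩, b)‖ := by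
        simp [g, gov, not_le.2 h1]
      rw [hgov, hS, shiftSum_sel_apply]
      by_cases hjK : j < K
      · simp [hjK]
        rw [neg_add_eq_sub]
        exact norm_le_norm_add_norm_sub' _ _
      · simp [hjK]
    refine sum_sq_le_of_chain (f := fun x => ‖τ x.1 x.2‖) (level := level) (pred := pred)
      (fun _ => norm_nonneg _) ?_ ?_ ?_ ?_ ?_
    · rintro ⟨⟨⟨i, hi⟩, a⟩, ⟨⟨j, hj⟩, b⟩⟩
      simp only [level]
      split_ifs <;> omega
    · rintro ⟨⟨⟨i, hi⟩, a⟩, ⟨⟨j, hj⟩, b⟩⟩ h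
      obtain ⟨rfl, rfl⟩ : i = 0 ∧ j = 0 := by
        simp only [level] at h
        split_ifs at h <;> omega
      simpa using hτ a b
    · rintro ⟨⟨⟨i, hi⟩, a⟩, ⟨⟨j, hj⟩, b⟩⟩ h
      simp only [level] at h
      by_cases hij : i < j
      · have := hupp i j hi hj a b hij
        rw [dif_neg (by split_ifs at h <;> omega), zero_add] at this
        exact this
      · have := hlow i j hi hj a b (by omega) (by split_ifs at h <;> omega)
        by_cases hj0 : 0 < j
        · obtain ⟨rfl, rfl⟩ : i = 1 ∧ j = 1 := by split_ifs at h <;> omega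
          have h00 := hτ a b
          simp only [Nat.sub_self, Fin.zero_eta, h00, norm_zero, ite_self, zero_add] at this
          exact this
        · rw [if_neg hj0, zero_add] at this
          exact this
    · rintro ⟨⟨⟨i, hi⟩, a⟩, ⟨⟨j, hj⟩, b⟩⟩ l h
      simp only [level] at h
      by_cases hij : i < j
      · have hjK : j < K := by split_ifs at h <;> omega
        have hle : ¬ j ≤ i := by omega
        have := hupp i j hi hj a b hij
        have hm1 : min (i + 1) K = i + 1 := by omega
        have hm2 : min (j + 1) K = j + 1 := by omega
        simp only [level, pred, hle, if_false, hm1, hm2]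
        rw [dif_pos hjK] at this
        refine ⟨?_, this⟩
        split_ifs at h ⊢ <;> omega
      · have hj0 : 0 < j := by split_ifs at h <;> omega
        have hle : j ≤ i := by omega
        have := hlow i j hi hj a b hle (by omega)
        simp only [level, pred, hle, if_true]
        rw [if_pos hj0] at this
        refine ⟨?_, this⟩
        split_ifs at h ⊢ <;> omega
    · rintro ⟨⟨⟨i, hi⟩, a⟩, ⟨⟨j, hj⟩, b⟩⟩ ⟨⟨⟨i', hi'⟩, a'⟩, ⟨⟨j', hj'⟩, b'⟩⟩ l h h' hpp
      simp only [level] at h h'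
      simp only [pred] at hpp
      simp only [Prod.mk.injEq, Fin.mk.injEq]
      split_ifs at hpp h h' <;> simp only [Prod.mk.injEq, Fin.mk.injEq] at hpp <;>
        obtain ⟨⟨h1, rfl⟩, h2, rfl⟩ := hpp <;> refine ⟨⟨?_, rfl⟩, ?_, rfl⟩ <;> omega
  have hg : ∑ x, g x ^ 2 ≤ frobSq S := by
    have hg2 : ∀ x, g x ^ 2 = (gov x).elim 0 fun y => ‖S y.1 y.2‖ ^ 2 := by
      intro x
      simp only [g]
      cases gov x <;> simp
    simp only [hg2]
    refine (sum_option_elim_le gov (fun _ => by positivity) ?_).trans_eq ?_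
    · rintro ⟨⟨⟨i, hi⟩, a⟩, ⟨⟨j, hj⟩, b⟩⟩ ⟨⟨⟨i', hi'⟩, a'⟩, ⟨⟨j', hj'⟩, b'⟩⟩
        ⟨⟨⟨p, hp⟩, c⟩, ⟨⟨q, hq⟩, d⟩⟩ h h'
      simp only [gov] at h h'
      simp only [Prod.mk.injEq, Fin.mk.injEq]
      split_ifs at h h' <;>
        simp only [Option.some.injEq, Prod.mk.injEq, Fin.mk.injEq] at h h' <;>
        obtain ⟨⟨h1, rfl⟩, h2, rfl⟩ := h <;> obtain ⟨⟨h3, rfl⟩, h4, rfl⟩ := h' <;>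
        refine ⟨⟨?_, rfl⟩, ?_, rfl⟩ <;> omega
    · rw [Fintype.sum_prod_type, frobSq]
  rw [Fintype.sum_prod_type] at hchain
  rw [frobSq]
  exact hchain.trans (mul_le_mul_of_nonneg_left hg (by positivity))

theorem shiftSum_sel (K n : ℕ) : shiftSum (-selTail F K n) (selInit F K n) = 0 := by
  ext1 p q
  have h := shiftSum_sel_apply (F := F) (K := K) (n := n) 1 p q
  simp only [Matrix.mul_one] at h
  rw [h]
  obtain ⟨⟨i, hi⟩, a⟩ := p
  obtain ⟨⟨j, hj⟩, b⟩ := q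
  simp only [Matrix.one_apply, Fin.succ_mk, Fin.castSucc_mk, Prod.mk.injEq, Fin.mk.injEq,
    Matrix.zero_apply]
  split_ifs <;> first | omega | simp

/-- A pencil annihilating `Λ ⊗ I` is a constant multiple of the Kronecker pencil. -/
theorem eq_mul_sel_of_shiftSum_eq_zero {K n : ℕ} {ρ : Type*}
    {Xc Yc : Matrix ρ (Fin (K + 1) × Fin n) F} (h : shiftSum Xc Yc = 0) :
    Xc = -(Yc.submatrix id (fun q : Fin K × Fin n => (q.1.castSucc, q.2)) * selTail F K n) ∧
      Yc = Yc.submatrix id (fun q : Fin K × Fin n => (q.1.castSucc, q.2)) * selInit F K n := by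
  constructor
  · ext1 r q
    obtain ⟨⟨j, hj⟩, b⟩ := q
    have h1 := congrFun (congrFun h r) (⟨j, by omega⟩, b)
    simp only [shiftSum, of_apply, hj, dite_true, Matrix.zero_apply] at h1
    rw [Matrix.neg_apply, mul_selTail_apply, eq_neg_iff_add_eq_zero]
    exact h1
  · ext1 r q
    rw [mul_selInit_apply]
    obtain ⟨⟨j, hj⟩, b⟩ := q
    split_ifs with hjK
    · rfl
    · obtain rfl : j = K := by simp only at hjK; omega
      have h1 := congrFun (congrFun h r) (⟨j + 1, by omega⟩, b)
      simp only [shiftSum, of_apply, lt_irrefl, dite_false, zero_add, Nat.succ_pos, dite_true,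
        Nat.add_sub_cancel, Matrix.zero_apply] at h1
      exact h1

section Restoration

open scoped Matrix.Norms.Frobenius

variable {K n : ℕ}

theorem norm_le_of_shiftSum_eq {τ : Matrix (Fin (K + 1) × Fin n) (Fin (K + 1) × Fin n) F}
    {G₁ G₀ : Matrix (Fin K × Fin n) (Fin (K + 1) × Fin n) F}
    (hτ : ∀ a b, τ (0, a) (0, b) = 0)
    (h : shiftSum (-(selTail F K n * τ)) (selInit F K n * τ) + shiftSum G₁ G₀ = 0) :
    ‖τ‖ ≤ √((K : ℝ) * (K + 1)) * penFrob G₁ G₀ := by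
  refine le_of_sq_le_sq ?_ (mul_nonneg (Real.sqrt_nonneg _) (penFrob_nonneg _ _))
  rw [mul_pow, Real.sq_sqrt (by positivity), penFrob_sq, ← frobSq_eq_norm_sq]
  have h1 := frobSq_le_frobSq_shiftSum τ hτ
  have h2 : frobSq (shiftSum (-(selTail F K n * τ)) (selInit F K n * τ)) ≤
      2 * (frobSq G₁ + frobSq G₀) := by
    rw [eq_neg_of_add_eq_zero_left h, frobSq_eq_norm_sq, norm_neg, ← frobSq_eq_norm_sq]
    exact frobSq_shiftSum_le G₁ G₀
  refine h1.trans ((mul_le_mul_of_nonneg_left h2 (by positivity)).trans_eq (by ring))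

/-- A small perturbation of the Kronecker pencil is strictly equivalent to it, by matrices close
to the identity. -/
theorem exists_strictEquiv_kronecker (hK : 1 ≤ K)
    (E₁ E₀ : Matrix (Fin K × Fin n) (Fin (K + 1) × Fin n) F)
    (hE : √((K : ℝ) * (K + 1)) * penFrob E₁ E₀ ≤ 1 / 4) :
    ∃ (τ : Matrix (Fin (K + 1) × Fin n) (Fin (K + 1) × Fin n) F)
      (W : Matrix (Fin K × Fin n) (Fin K × Fin n) F),
      IsUnit (1 + τ) ∧ IsUnit W ∧
      (-selTail F K n + E₁) * (1 + τ) = -(W * selTail F K n) ∧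
      (selInit F K n + E₀) * (1 + τ) = W * selInit F K n ∧
      ‖τ‖ ≤ 4 / 3 * ((K + 1) * penFrob E₁ E₀) ∧ ‖τ‖ ≤ 1 / 3 := by
  set c := √((K : ℝ) * (K + 1)) with hc
  set e := penFrob E₁ E₀ with he
  have he0 : 0 ≤ e := penFrob_nonneg _ _
  have hK' : (1 : ℝ) ≤ K := by exact_mod_cast hK
  have hc1 : 1 ≤ c := Real.one_le_sqrt.2 (by nlinarith)
  have hcK : c ≤ K + 1 := by
    rw [hc, Real.sqrt_le_left (by positivity)]
    nlinarith
  let Φ : Matrix (Fin (K + 1) × Fin n) (Fin (K + 1) × Fin n) F →ₗ[F]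
      Matrix (Fin K × Fin n) (Fin (K + 2) × Fin n) F × Matrix (Fin n) (Fin n) F :=
    { toFun := fun τ => (shiftSum ((-selTail F K n + E₁) * τ) ((selInit F K n + E₀) * τ),
        τ.submatrix (fun a => (0, a)) (fun b => (0, b)))
      map_add' := fun τ τ' => by
        simp only [Matrix.mul_add, shiftSum_add, submatrix_add]
        rfl
      map_smul' := fun a τ => by
        simp only [Matrix.mul_smul, shiftSum_smul, submatrix_smul, RingHom.id_apply]
        rfl }
  have hΦ : ∀ τ, (Φ τ).1 = shiftSum (-(selTail F K n * τ)) (selInit F K n * τ) +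
      shiftSum (E₁ * τ) (E₀ * τ) := fun τ => by
    rw [← shiftSum_add, ← Matrix.neg_mul, ← Matrix.add_mul, ← Matrix.add_mul]
    rfl
  have hinj : Function.Injective Φ := by
    rw [← LinearMap.ker_eq_bot, LinearMap.ker_eq_bot']
    intro τ hτ
    have h1 := norm_le_of_shiftSum_eq (τ := τ) (G₁ := E₁ * τ) (G₀ := E₀ * τ)
      (fun a b => congrFun (congrFun (congrArg Prod.snd hτ) a) b)
      (by rw [← hΦ, hτ]; rfl)
    have h2 := h1.trans (mul_le_mul_of_nonneg_left (penFrob_mul_le E₁ E₀ τ)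
      (Real.sqrt_nonneg _))
    rw [← mul_assoc] at h2
    have h3 := h2.trans (mul_le_mul_of_nonneg_right hE (norm_nonneg τ))
    exact norm_le_zero_iff.1 (by linarith)
  have hsurj : Function.Surjective Φ := by
    refine (LinearMap.injective_iff_surjective_of_finrank_eq_finrank ?_).1 hinj
    simp only [Module.finrank_prod, Module.finrank_matrix, Fintype.card_prod, Fintype.card_fin,
      Module.finrank_self, mul_one]
    ring
  obtain ⟨τ, hτ⟩ := hsurj (-shiftSum E₁ E₀, 0)
  have hker : shiftSum (-(selTail F K n * τ)) (selInit F K n * τ) +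
      shiftSum (E₁ + E₁ * τ) (E₀ + E₀ * τ) = 0 := by
    rw [shiftSum_add, add_left_comm, ← hΦ, hτ, add_neg_cancel]
  have hpen : penFrob (E₁ + E₁ * τ) (E₀ + E₀ * τ) ≤ e + e * ‖τ‖ :=
    (penFrob_add_le _ _ _ _).trans (add_le_add le_rfl (penFrob_mul_le _ _ _))
  have hnorm : ‖τ‖ ≤ c * e * (1 + ‖τ‖) := by
    refine (norm_le_of_shiftSum_eq
      (fun a b => congrFun (congrFun (congrArg Prod.snd hτ) a) b) hker).trans ?_
    refine (mul_le_mul_of_nonneg_left hpen (Real.sqrt_nonneg _)).trans_eq ?_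
    ring
  have hτ0 := norm_nonneg τ
  have hce : 0 ≤ c * e := by positivity
  have h13 : ‖τ‖ ≤ 1 / 3 := by nlinarith
  have hbound : ‖τ‖ ≤ 4 / 3 * ((K + 1) * e) := by
    have h1 : ‖τ‖ ≤ 4 / 3 * (c * e) := by nlinarith
    have h2 : c * e ≤ (K + 1) * e := mul_le_mul_of_nonneg_right hcK he0
    linarith
  have hzero : shiftSum ((-selTail F K n + E₁) * (1 + τ)) ((selInit F K n + E₀) * (1 + τ)) = 0 := by
    have hX : (-selTail F K n + E₁) * (1 + τ) =
        -selTail F K n + (-(selTail F K n * τ) + (E₁ + E₁ * τ)) := by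
      simp only [Matrix.add_mul, Matrix.mul_add, Matrix.mul_one, Matrix.neg_mul]
      abel
    have hY : (selInit F K n + E₀) * (1 + τ) =
        selInit F K n + (selInit F K n * τ + (E₀ + E₀ * τ)) := by
      simp only [Matrix.add_mul, Matrix.mul_add, Matrix.mul_one]
      abel
    rw [hX, hY, shiftSum_add, shiftSum_add, hker, shiftSum_sel, add_zero]
  obtain ⟨hX, hY⟩ := eq_mul_sel_of_shiftSum_eq_zero hzero
  refine ⟨τ, _, isUnit_one_add_of_norm_lt_one (by linarith), ?_, hX, hY, hbound, h13⟩
  have hcast : Function.Injective fun q : Fin K × Fin n => (q.1.castSucc, q.2) := by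
    rintro ⟨i, a⟩ ⟨j, b⟩ h
    simpa using h
  have hW : ((selInit F K n + E₀) * (1 + τ)).submatrix id
      (fun q : Fin K × Fin n => (q.1.castSucc, q.2)) =
      1 + (τ.submatrix (fun q : Fin K × Fin n => (q.1.castSucc, q.2))
          (fun q : Fin K × Fin n => (q.1.castSucc, q.2)) +
        (E₀ + E₀ * τ).submatrix id (fun q : Fin K × Fin n => (q.1.castSucc, q.2))) := by
    ext1 p q
    simp only [Matrix.add_mul, Matrix.mul_add, Matrix.mul_one, submatrix_apply, Matrix.add_apply,
      selInit_mul_apply, id]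
    have : selInit F K n p (q.1.castSucc, q.2) = (1 : Matrix _ _ F) p q := by
      simp [selInit, Matrix.one_apply, Prod.ext_iff]
    rw [this]
    ring
  rw [hW]
  refine isUnit_one_add_of_norm_lt_one ?_
  have h1 := norm_submatrix_le τ hcast hcast
  have h2 := norm_submatrix_le (E₀ + E₀ * τ) Function.injective_id hcast
  have h3 := norm_le_penFrob_right (E₁ + E₁ * τ) (E₀ + E₀ * τ)
  have h4 : e ≤ 1 / 4 := by nlinarith
  refine (norm_add_le _ _).trans_lt ?_
  nlinarith

end Restoration

/-! ### Trimmed pencils and their perturbations -/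

section Trimmed

variable {K m n : ℕ}

theorem LtX_eq_fromRows (α : F) (Ak : Matrix (Fin m) (Fin n) F)
    (X12 : Matrix (Fin m) (Fin K × Fin n) F) (R : Matrix (Fin K × Fin n) (Fin K × Fin n) F) :
    LtX (k := K + 1) α Ak X12 R =
      fromRows (Matrix.of fun i q => LtX (k := K + 1) α Ak X12 R (Sum.inl i) q)
        (-(R * selTail F K n)) := by
  ext1 (i | p) q
  · rfl
  · rw [fromRows_apply_inr, Matrix.neg_apply, mul_selTail_apply]
    simp only [LtX, of_apply, Sum.elim_inr]
    split_ifs with h0 h1 h1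
    · omega
    · rw [neg_zero]
    · rfl
    · omega

theorem LtY_eq_fromRows (α : F) (A0 : Matrix (Fin m) (Fin n) F)
    (Y11 : Matrix (Fin m) (Fin K × Fin n) F) (R : Matrix (Fin K × Fin n) (Fin K × Fin n) F) :
    LtY (k := K + 1) α A0 Y11 R =
      fromRows (Matrix.of fun i q => LtY (k := K + 1) α A0 Y11 R (Sum.inl i) q)
        (R * selInit F K n) := by
  ext1 (i | p) q
  · rfl
  · rw [fromRows_apply_inr, mul_selInit_apply]
    rfl

theorem coeffFam_LtX_LtY {α : F} (hα : α ≠ 0) (A : Fin (K + 1 + 1) → Matrix (Fin m) (Fin n) F)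
    {X12 Y11 : Matrix (Fin m) (Fin K × Fin n) F}
    (hXY : ∀ (i : Fin m) (p : Fin K × Fin n),
      X12 i p + Y11 i p = α * A (⟨K - (p.1 : ℕ), by omega⟩) i p.2)
    (R : Matrix (Fin K × Fin n) (Fin K × Fin n) F) :
    coeffFam
      (α⁻¹ • Matrix.of fun i q => LtX (k := K + 1) α (A (Fin.last (K + 1))) X12 R (Sum.inl i) q)
      (α⁻¹ • Matrix.of fun i q => LtY (k := K + 1) α (A 0) Y11 R (Sum.inl i) q) = A := by
  funext i
  ext1 r c
  obtain ⟨i, hi⟩ := i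
  simp only [coeffFam, shiftSum, of_apply, Matrix.smul_apply, smul_eq_mul, LtX, LtY,
    Sum.elim_inl, Fin.val_rev, Nat.add_sub_cancel]
  rcases Nat.eq_zero_or_pos i with rfl | hpos
  · rw [dif_neg (by omega), dif_pos (by omega), dif_neg (by omega), zero_add,
      inv_mul_cancel_left₀ hα]
    rfl
  rcases (Nat.lt_succ_iff.1 hi).eq_or_lt with rfl | hlt
  · rw [dif_pos (by omega), dif_pos (by omega), dif_neg (by omega), add_zero,
      inv_mul_cancel_left₀ hα]
    rfl
  · rw [dif_pos (by omega), dif_neg (by omega), dif_pos (by omega), dif_pos (by omega),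
      ← mul_add, hXY, inv_mul_cancel_left₀ hα]
    congr 3
    simp only
    omega

theorem fromRows_eq_fromBlocks_mul {α : F} (hα : α ≠ 0) {γ : Type*} (Xt : Matrix (Fin m) γ F)
    (M : Matrix (Fin K × Fin n) (Fin K × Fin n) F) (V : Matrix (Fin K × Fin n) γ F) :
    fromRows Xt (M * V) = fromBlocks (α • (1 : Matrix (Fin m) (Fin m) F)) 0 0 M *
      fromRows (α⁻¹ • Xt) V := by
  rw [fromBlocks_mul_fromRows]
  simp [smul_smul, hα]

theorem isUnit_fromBlocks_smul {α : F} (hα : α ≠ 0)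
    {M : Matrix (Fin K × Fin n) (Fin K × Fin n) F} (hM : IsUnit M) :
    IsUnit (fromBlocks (α • (1 : Matrix (Fin m) (Fin m) F)) 0 0 M) := by
  rw [isUnit_iff_isUnit_det, det_fromBlocks_zero₁₂]
  refine IsUnit.mul ?_ ((isUnit_iff_isUnit_det M).1 hM)
  rw [det_smul, det_one, mul_one]
  exact (isUnit_iff_ne_zero.2 hα).pow _

theorem penFrob_toRows₁_le {ρ ρ' γ : Type*} [Fintype ρ] [Fintype ρ'] [Fintype γ]
    (Xc Yc : Matrix (ρ ⊕ ρ') γ F) : penFrob Xc.toRows₁ Yc.toRows₁ ≤ penFrob Xc Yc :=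
  Real.sqrt_le_sqrt (add_le_add
    (frobSq_submatrix_le Xc Sum.inl_injective Function.injective_id)
    (frobSq_submatrix_le Yc Sum.inl_injective Function.injective_id))

theorem penFrob_toRows₂_le {ρ ρ' γ : Type*} [Fintype ρ] [Fintype ρ'] [Fintype γ]
    (Xc Yc : Matrix (ρ ⊕ ρ') γ F) : penFrob Xc.toRows₂ Yc.toRows₂ ≤ penFrob Xc Yc :=
  Real.sqrt_le_sqrt (add_le_add
    (frobSq_submatrix_le Xc Sum.inr_injective Function.injective_id)
    (frobSq_submatrix_le Yc Sum.inr_injective Function.injective_id))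

theorem mul_fromRows_add_eq {γ : Type*} [Fintype γ] [DecidableEq γ] {α : F} (hα : α ≠ 0)
    {D : Matrix (Fin m ⊕ (Fin K × Fin n)) (Fin m ⊕ (Fin K × Fin n)) F} (hD : IsUnit D.det)
    {R : Matrix (Fin K × Fin n) (Fin K × Fin n) F} (hR : IsUnit R.det)
    {T : Matrix γ γ F} (hT : IsUnit T.det) {W : Matrix (Fin K × Fin n) (Fin K × Fin n) F}
    (Zt : Matrix (Fin m) γ F) (V : Matrix (Fin K × Fin n) γ F)
    (Δ : Matrix (Fin m ⊕ (Fin K × Fin n)) γ F)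
    (hV : (V + R⁻¹ * (D⁻¹ * Δ).toRows₂) * T = W * V) :
    D * fromRows Zt (R * V) + Δ =
      D * fromBlocks (α • (1 : Matrix (Fin m) (Fin m) F)) 0 0 (R * W) *
        fromRows (α⁻¹ • ((Zt + (D⁻¹ * Δ).toRows₁) * T)) V * T⁻¹ := by
  have hrows : fromRows (Zt + (D⁻¹ * Δ).toRows₁) (R * (V + R⁻¹ * (D⁻¹ * Δ).toRows₂)) * T =
      fromRows ((Zt + (D⁻¹ * Δ).toRows₁) * T) (R * W * V) := by
    rw [fromRows_mul, Matrix.mul_assoc R, hV, Matrix.mul_assoc R]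
  have hsum : fromRows Zt (R * V) + D⁻¹ * Δ =
      fromRows (Zt + (D⁻¹ * Δ).toRows₁) (R * (V + R⁻¹ * (D⁻¹ * Δ).toRows₂)) := by
    rw [Matrix.mul_add, mul_nonsing_inv_cancel_left R _ hR]
    ext (i | i) j <;> rfl
  rw [Matrix.mul_assoc D, ← fromRows_eq_fromBlocks_mul hα, ← hrows, ← hsum, Matrix.mul_assoc D,
    mul_nonsing_inv_cancel_right T _ hT, Matrix.mul_add, mul_nonsing_inv_cancel_left D _ hD]

/-- A small perturbation of a trimmed pencil is strictly equivalent to a block pencil of the same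
kind. -/
theorem exists_strictEquiv_trimmed {α : F} (hα : α ≠ 0)
    (At Bt : Matrix (Fin m) (Fin (K + 1) × Fin n) F)
    {R : Matrix (Fin K × Fin n) (Fin K × Fin n) F} (hR : IsUnit R) (hσR : 0 < sigmaMin R)
    {D : Matrix (Fin m ⊕ (Fin K × Fin n)) (Fin m ⊕ (Fin K × Fin n)) F} (hD : IsUnit D)
    (hσD : 0 < sigmaMin D)
    (ΔX ΔY : Matrix (Fin m ⊕ (Fin K × Fin n)) (Fin (K + 1) × Fin n) F)
    (hΔ : penFrob ΔX ΔY < sigmaMin R * sigmaMin D / (2 * ((K + 1 : ℕ) : ℝ) ^ ((3 : ℝ) / 2))) :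
    ∃ (Xp Yp : Matrix (Fin m) (Fin (K + 1) × Fin n) F)
      (S : Matrix (Fin m ⊕ (Fin K × Fin n)) (Fin m ⊕ (Fin K × Fin n)) F)
      (T : Matrix (Fin (K + 1) × Fin n) (Fin (K + 1) × Fin n) F), IsUnit S ∧ IsUnit T ∧
      D * fromRows At (-(R * selTail F K n)) + ΔX =
        S * fromRows (α⁻¹ • (At + Xp)) (-selTail F K n) * T ∧
      D * fromRows Bt (R * selInit F K n) + ΔY =
        S * fromRows (α⁻¹ • (Bt + Yp)) (selInit F K n) * T ∧
      √2 * penFrob Xp Yp ≤ penFrob (D⁻¹ * ΔX) (D⁻¹ * ΔY) *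
        (3 + 2 * ((K + 1 : ℕ) : ℝ) * penFrob At Bt / sigmaMin R) := by
  open scoped Matrix.Norms.Frobenius in
  have hne : Nonempty (Fin K × Fin n) := by
    by_contra h
    rw [not_nonempty_iff] at h
    exact hσR.ne' (sigmaMin_eq_zero_of_isEmpty R)
  have hK : 1 ≤ K := hne.some.1.pos
  have hRdet := (isUnit_iff_isUnit_det R).1 hR
  have hDdet := (isUnit_iff_isUnit_det D).1 hD
  set d := penFrob (D⁻¹ * ΔX) (D⁻¹ * ΔY) with hd
  set E₁ := R⁻¹ * (D⁻¹ * ΔX).toRows₂ with hE₁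
  set E₀ := R⁻¹ * (D⁻¹ * ΔY).toRows₂ with hE₀
  have hd0 : 0 ≤ d := penFrob_nonneg _ _
  have he0 : 0 ≤ penFrob E₁ E₀ := penFrob_nonneg _ _
  have hdΔ : sigmaMin D * d ≤ penFrob ΔX ΔY := by
    have := sigmaMin_mul_penFrob_le D (D⁻¹ * ΔX) (D⁻¹ * ΔY)
    rwa [mul_nonsing_inv_cancel_left D _ hDdet, mul_nonsing_inv_cancel_left D _ hDdet] at this
  have hed : sigmaMin R * penFrob E₁ E₀ ≤ d := by
    have := sigmaMin_mul_penFrob_le R E₁ E₀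
    rw [mul_nonsing_inv_cancel_left R _ hRdet, mul_nonsing_inv_cancel_left R _ hRdet] at this
    exact this.trans (penFrob_toRows₂_le _ _)
  have hsmall : √((K : ℝ) * (K + 1)) * penFrob E₁ E₀ ≤ 1 / 4 := by
    set s := ((K + 1 : ℕ) : ℝ) ^ ((3 : ℝ) / 2) with hs
    have hs0 : 0 < s := by positivity
    have hs2 : s ^ 2 = ((K : ℝ) + 1) ^ 3 := by
      rw [hs, ← Real.rpow_natCast, ← Real.rpow_mul (by positivity)]
      norm_num
    have h1 : penFrob E₁ E₀ * (2 * s) < 1 := by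
      rw [lt_div_iff₀ (by positivity)] at hΔ
      have h2 : sigmaMin R * sigmaMin D * penFrob E₁ E₀ ≤ penFrob ΔX ΔY := by nlinarith
      have h3 : sigmaMin R * sigmaMin D * (penFrob E₁ E₀ * (2 * s)) <
          sigmaMin R * sigmaMin D * 1 := by
        nlinarith [mul_le_mul_of_nonneg_right h2 (by positivity : 0 ≤ 2 * s)]
      exact lt_of_mul_lt_mul_left h3 (by positivity)
    have h2 : √((K : ℝ) * (K + 1)) ≤ s / 2 := by
      rw [Real.sqrt_le_left (by positivity), div_pow, hs2]
      have : (0 : ℝ) ≤ K := K.cast_nonneg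
      nlinarith [mul_nonneg (sq_nonneg ((K : ℝ) - 1)) (by positivity : (0 : ℝ) ≤ K + 1)]
    nlinarith
  obtain ⟨τ, W, hT, hW, hX, hY, hτ, hτ3⟩ := exists_strictEquiv_kronecker hK E₁ E₀ hsmall
  have hTdet := (isUnit_iff_isUnit_det _).1 hT
  have hX' : (-selTail F K n + E₁) * (1 + τ) = W * -selTail F K n := by
    rw [hX, Matrix.mul_neg]
  refine ⟨At * τ + ((D⁻¹ * ΔX).toRows₁ * τ + (D⁻¹ * ΔX).toRows₁),
    Bt * τ + ((D⁻¹ * ΔY).toRows₁ * τ + (D⁻¹ * ΔY).toRows₁),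
    D * fromBlocks (α • (1 : Matrix (Fin m) (Fin m) F)) 0 0 (R * W), (1 + τ)⁻¹,
    hD.mul (isUnit_fromBlocks_smul hα (hR.mul hW)), ?_, ?_, ?_, ?_⟩
  · exact (isUnit_nonsing_inv_iff (A := 1 + τ)).2 hT
  · rw [← Matrix.mul_neg, mul_fromRows_add_eq hα hDdet hRdet hTdet At _ ΔX hX']
    congr 4
    rw [Matrix.mul_add, Matrix.mul_one, Matrix.add_mul]
    abel
  · rw [mul_fromRows_add_eq hα hDdet hRdet hTdet Bt _ ΔY hY]
    congr 4
    rw [Matrix.mul_add, Matrix.mul_one, Matrix.add_mul]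
    abel
  · set a := penFrob At Bt with ha
    set t := ‖τ‖ with ht
    have ha0 : 0 ≤ a := penFrob_nonneg _ _
    have hd₁ : penFrob (D⁻¹ * ΔX).toRows₁ (D⁻¹ * ΔY).toRows₁ ≤ d := penFrob_toRows₁_le _ _
    have ht0 : 0 ≤ t := norm_nonneg _
    have hp : penFrob (At * τ + ((D⁻¹ * ΔX).toRows₁ * τ + (D⁻¹ * ΔX).toRows₁))
        (Bt * τ + ((D⁻¹ * ΔY).toRows₁ * τ + (D⁻¹ * ΔY).toRows₁)) ≤ a * t + (d * t + d) := by
      refine (penFrob_add_le _ _ _ _).trans (add_le_add (penFrob_mul_le _ _ _) ?_)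
      refine (penFrob_add_le _ _ _ _).trans (add_le_add ?_ hd₁)
      exact (penFrob_mul_le _ _ _).trans (mul_le_mul_of_nonneg_right hd₁ ht0)
    have hs2 : √2 ≤ 3 / 2 := by
      rw [Real.sqrt_le_left (by norm_num)]
      norm_num
    have hed' : penFrob E₁ E₀ ≤ d / sigmaMin R := by
      rw [le_div_iff₀ hσR]
      linarith
    have hat : a * t ≤ 4 / 3 * ((K + 1) * a * (d / sigmaMin R)) := by
      calc a * t ≤ a * (4 / 3 * ((K + 1) * (d / sigmaMin R))) := by
            gcongr
            exact hτ.trans (by gcongr)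
        _ = _ := by ring
    calc _ ≤ 3 / 2 * (a * t + (d * t + d)) := mul_le_mul hs2 hp (penFrob_nonneg _ _) (by norm_num)
      _ ≤ 3 / 2 * (4 / 3 * ((K + 1) * a * (d / sigmaMin R)) + (d * (1 / 3) + d)) := by gcongr
      _ = d * (2 + 2 * (K + 1) * a / sigmaMin R) := by ring
      _ ≤ _ := by
        push_cast
        gcongr
        norm_num

end Trimmed

section PerturbationBounds

variable {K m n : ℕ}

theorem penFrob_selTail_selInit_pos [Nonempty (Fin K × Fin n)] :
    0 < penFrob (-selTail F K n) (selInit F K n) := by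
  have hmem : 0 < frobSq (selInit F K n) := by
    obtain ⟨p⟩ := ‹Nonempty (Fin K × Fin n)›
    refine Finset.sum_pos' (fun i _ => Finset.sum_nonneg fun j _ => sq_nonneg _)
      ⟨p, Finset.mem_univ _, Finset.sum_pos' (fun j _ => sq_nonneg _)
        ⟨(p.1.castSucc, p.2), Finset.mem_univ _, ?_⟩⟩
    simp [selInit]
  exact Real.sqrt_pos.2 (add_pos_of_nonneg_of_pos (frobSq_nonneg _) hmem)

theorem penFrob_mul_fromRows_pos (At Bt : Matrix (Fin m) (Fin (K + 1) × Fin n) F)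
    {R : Matrix (Fin K × Fin n) (Fin K × Fin n) F} (hσR : 0 < sigmaMin R)
    {D : Matrix (Fin m ⊕ (Fin K × Fin n)) (Fin m ⊕ (Fin K × Fin n)) F} (hσD : 0 < sigmaMin D) :
    0 < penFrob (D * fromRows At (-(R * selTail F K n)))
      (D * fromRows Bt (R * selInit F K n)) := by
  have hne : Nonempty (Fin K × Fin n) := by
    by_contra h
    rw [not_nonempty_iff] at h
    exact hσR.ne' (sigmaMin_eq_zero_of_isEmpty R)
  have hrows := penFrob_toRows₂_le (fromRows At (-(R * selTail F K n)))
    (fromRows Bt (R * selInit F K n))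
  rw [toRows₂_fromRows, toRows₂_fromRows, ← Matrix.mul_neg] at hrows
  have hR := sigmaMin_mul_penFrob_le R (-selTail F K n) (selInit F K n)
  have hD := sigmaMin_mul_penFrob_le D (fromRows At (-(R * selTail F K n)))
    (fromRows Bt (R * selInit F K n))
  rw [← Matrix.mul_neg] at hD ⊢
  exact (mul_pos hσD ((mul_pos hσR penFrob_selTail_selInit_pos).trans_le
    (hR.trans hrows))).trans_le hD

theorem coeffFam_smul_add (a : F) (X₁ X₂ Y₁ Y₂ : Matrix (Fin m) (Fin (K + 1) × Fin n) F) :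
    coeffFam (a • (X₁ + X₂)) (a • (Y₁ + Y₂)) =
      fun i => coeffFam (a • X₁) (a • Y₁) i + coeffFam (a • X₂) (a • Y₂) i := by
  funext i
  simp only [coeffFam, smul_add, shiftSum_add]
  rfl

open scoped Matrix.Norms.Frobenius in
theorem famFrob_coeffFam_smul_le (a : F) (Xc Yc : Matrix (Fin m) (Fin (K + 1) × Fin n) F) :
    famFrob (coeffFam (a • Xc) (a • Yc)) ≤ ‖a‖ * (√2 * penFrob Xc Yc) := by
  rw [famFrob_coeffFam, shiftSum_smul, norm_smul]
  exact mul_le_mul_of_nonneg_left (norm_shiftSum_le Xc Yc) (norm_nonneg a)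

end PerturbationBounds

/-- Let `m > n` and let `L_t(λ) = D̃ L̂_t(λ)` be a linearization of
`P(λ)` obtained by trimming a full-`Z`-rank g-linearization in `𝕃₁(P)`, where `D̃` is
nonsingular and `L̂_t(λ) = λ[[αA_k, X₁₂],[0, −R̃]] + [[Y₁₁, αA₀],[R̃, 0]]` (with `α ≠ 0`,
`X₁₂ + Y₁₁ = α[A_{k−1} ⋯ A₁]`, `R̃` nonsingular upper triangular); `A(λ)` denotes the
top block of `L̂_t`. For every pencil `ΔL_t` with
`‖ΔL_t‖_F < σ_min(R̃)σ_min(D̃)/(2k^{3/2})`, the pencil `L_t + ΔL_t` is a strong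
linearization of a grade-`k` matrix polynomial `P + ΔP` with
`‖ΔP‖_F/‖P‖_F ≤ C ‖ΔL_t‖_F/‖L_t‖_F`, where
`C = (κ₂(D̃)/|α|)(‖L̂_t‖_F/‖P‖_F)(3 + 2k‖A‖_F/σ_min(R̃))`; moreover the right minimal
indices of `L_t + ΔL_t` are those of `P + ΔP` shifted by `k−1` and the left minimal
indices agree, exactly as for `L_t` and `P`. -/
theorem statement_19 {F : Type*} [RCLike F] {k m n : ℕ} (hk : 0 < k) (hmn : n < m)
    (A : Fin (k + 1) → Matrix (Fin m) (Fin n) F)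
    (α : F) (hα : α ≠ 0)
    (X12 Y11 : Matrix (Fin m) (Fin (k - 1) × Fin n) F)
    (hXY : ∀ (i : Fin m) (p : Fin (k - 1) × Fin n),
      X12 i p + Y11 i p = α * A (⟨k - 1 - (p.1 : ℕ), by omega⟩) i p.2)
    (R : Matrix (Fin (k - 1) × Fin n) (Fin (k - 1) × Fin n) F) (hR : IsUnit R)
    (hRtri : ∀ p q : Fin (k - 1) × Fin n,
      (q.1 : ℕ) * n + (q.2 : ℕ) < (p.1 : ℕ) * n + (p.2 : ℕ) → R p q = 0)
    (Xh Yh : Matrix (Fin m ⊕ (Fin (k - 1) × Fin n)) (Fin k × Fin n) F)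
    (hXh : Xh = LtX α (A (Fin.last k)) X12 R)
    (hYh : Yh = LtY α (A 0) Y11 R)
    (Dm : Matrix (Fin m ⊕ (Fin (k - 1) × Fin n)) (Fin m ⊕ (Fin (k - 1) × Fin n)) F)
    (hDm : IsUnit Dm)
    (hlin : IsStrongLin ((k - 1) * n) A (pencil (Dm * Xh) (Dm * Yh)))
    (At Bt : Matrix (Fin m) (Fin k × Fin n) F)
    (hAt : At = Matrix.of fun i q => Xh (Sum.inl i) q)
    (hBt : Bt = Matrix.of fun i q => Yh (Sum.inl i) q)
    (ΔXc ΔYc : Matrix (Fin m ⊕ (Fin (k - 1) × Fin n)) (Fin k × Fin n) F)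
    (hΔ : penFrob ΔXc ΔYc <
      sigmaMin R * sigmaMin Dm / (2 * (k : ℝ) ^ ((3 : ℝ) / 2))) :
    ∃ ΔA : Fin (k + 1) → Matrix (Fin m) (Fin n) F,
      IsStrongLin ((k - 1) * n) (fun i => A i + ΔA i)
        (pencil (Dm * Xh + ΔXc) (Dm * Yh + ΔYc)) ∧
      famFrob ΔA / famFrob A ≤
        (cond2 Dm / ‖α‖ * (penFrob Xh Yh / famFrob A) *
            (3 + 2 * (k : ℝ) * penFrob At Bt / sigmaMin R)) *
          (penFrob ΔXc ΔYc / penFrob (Dm * Xh) (Dm * Yh)) ∧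
      (∀ (d : ℕ) (ε : Fin d → ℕ),
        HasMinIndices (Nr (matPoly fun i => A i + ΔA i)) ε ↔
          HasMinIndices (Nr (pencil (Dm * Xh + ΔXc) (Dm * Yh + ΔYc)))
            fun i => ε i + (k - 1)) ∧
      (∀ (d : ℕ) (δ : Fin d → ℕ),
        HasMinIndices (Nl (matPoly fun i => A i + ΔA i)) δ ↔
          HasMinIndices (Nl (pencil (Dm * Xh + ΔXc) (Dm * Yh + ΔYc))) δ) ∧
      (∀ (d : ℕ) (ε : Fin d → ℕ),
        HasMinIndices (Nr (matPoly A)) ε ↔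
          HasMinIndices (Nr (pencil (Dm * Xh) (Dm * Yh))) fun i => ε i + (k - 1)) ∧
      (∀ (d : ℕ) (δ : Fin d → ℕ),
        HasMinIndices (Nl (matPoly A)) δ ↔
          HasMinIndices (Nl (pencil (Dm * Xh) (Dm * Yh))) δ) := by
  obtain ⟨K, rfl⟩ : ∃ K, k = K + 1 := ⟨k - 1, by omega⟩
  change Matrix (Fin m) (Fin K × Fin n) F at X12 Y11
  change Matrix (Fin K × Fin n) (Fin K × Fin n) F at R
  change Matrix (Fin m ⊕ (Fin K × Fin n)) (Fin m ⊕ (Fin K × Fin n)) F at Dm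
  change Matrix (Fin m ⊕ (Fin K × Fin n)) (Fin (K + 1) × Fin n) F at Xh Yh ΔXc ΔYc
  have hσ : 0 < sigmaMin R * sigmaMin Dm := by
    have h := (penFrob_nonneg ΔXc ΔYc).trans_lt hΔ
    rwa [lt_div_iff₀ (by positivity), zero_mul] at h
  have hσR : 0 < sigmaMin R := pos_of_mul_pos_left hσ (sigmaMin_nonneg Dm)
  have hσD : 0 < sigmaMin Dm := pos_of_mul_pos_right hσ (sigmaMin_nonneg R)
  have hA : coeffFam (α⁻¹ • At) (α⁻¹ • Bt) = A := by
    rw [hAt, hBt, hXh, hYh]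
    exact coeffFam_LtX_LtY hα A hXY R
  have hXrows : Xh = fromRows At (-(R * selTail F K n)) := by
    rw [hAt, hXh]
    exact LtX_eq_fromRows α _ X12 R
  have hYrows : Yh = fromRows Bt (R * selInit F K n) := by
    rw [hBt, hYh]
    exact LtY_eq_fromRows α _ Y11 R
  clear hXh hYh hAt hBt
  obtain ⟨Xp, Yp, S, T, hS, hT, hXS, hYS, hp⟩ :=
    exists_strictEquiv_trimmed hα At Bt hR hσR hDm hσD ΔXc ΔYc hΔ
  have hS' := nonsing_inv_mul S ((isUnit_iff_isUnit_det S).1 hS)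
  have hT' := mul_nonsing_inv T ((isUnit_iff_isUnit_det T).1 hT)
  have hS₀ : IsUnit (Dm * fromBlocks (α • (1 : Matrix (Fin m) (Fin m) F)) 0 0 R) :=
    hDm.mul (isUnit_fromBlocks_smul hα hR)
  have hS₀' := nonsing_inv_mul _ ((isUnit_iff_isUnit_det _).1 hS₀)
  have hT₀ : (1 : Matrix (Fin (K + 1) × Fin n) (Fin (K + 1) × Fin n) F) * 1 = 1 := mul_one 1
  have hX₀ : Dm * Xh = Dm * fromBlocks (α • (1 : Matrix (Fin m) (Fin m) F)) 0 0 R *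
      fromRows (α⁻¹ • At) (-selTail F K n) *
        (1 : Matrix (Fin (K + 1) × Fin n) (Fin (K + 1) × Fin n) F) := by
    rw [Matrix.mul_one, Matrix.mul_assoc, ← fromRows_eq_fromBlocks_mul hα, hXrows, Matrix.mul_neg]
  have hY₀ : Dm * Yh = Dm * fromBlocks (α • (1 : Matrix (Fin m) (Fin m) F)) 0 0 R *
      fromRows (α⁻¹ • Bt) (selInit F K n) *
        (1 : Matrix (Fin (K + 1) × Fin n) (Fin (K + 1) × Fin n) F) := by
    rw [Matrix.mul_one, Matrix.mul_assoc, ← fromRows_eq_fromBlocks_mul hα, hYrows]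
  have hsum : (fun i => A i + coeffFam (α⁻¹ • Xp) (α⁻¹ • Yp) i) =
      coeffFam (α⁻¹ • (At + Xp)) (α⁻¹ • (Bt + Yp)) := by
    rw [coeffFam_smul_add, hA]
  have hl : 0 < penFrob (Dm * Xh) (Dm * Yh) := by
    rw [hXrows, hYrows]
    exact penFrob_mul_fromRows_pos At Bt hσR hσD
  rw [← hXrows] at hXS
  rw [← hYrows] at hYS
  refine ⟨coeffFam (α⁻¹ • Xp) (α⁻¹ • Yp), ?_, ?_, ?_, ?_, ?_, ?_⟩
  · rw [hsum, hXS, hYS]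
    exact isStrongLin_strictEquiv hS' hT' _ _
  · set C := 3 + 2 * ((K + 1 : ℕ) : ℝ) * penFrob At Bt / sigmaMin R with hC
    have hC0 : 0 ≤ C := by
      have := penFrob_nonneg At Bt
      positivity
    have hd := penFrob_mul_le_norm2 Dm⁻¹ ΔXc ΔYc
    have hL := penFrob_mul_le_norm2 Dm Xh Yh
    have hα0 : 0 < ‖α‖ := norm_pos_iff.2 hα
    have hδ : 0 ≤ norm2 Dm⁻¹ * penFrob ΔXc ΔYc :=
      mul_nonneg (norm2_nonneg _) (penFrob_nonneg _ _)
    have hbound : famFrob (coeffFam (α⁻¹ • Xp) (α⁻¹ • Yp)) ≤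
        cond2 Dm / ‖α‖ * penFrob Xh Yh * C * (penFrob ΔXc ΔYc / penFrob (Dm * Xh) (Dm * Yh)) :=
      calc _ ≤ ‖α⁻¹‖ * (√2 * penFrob Xp Yp) := famFrob_coeffFam_smul_le _ _ _
        _ ≤ ‖α‖⁻¹ * (norm2 Dm⁻¹ * penFrob ΔXc ΔYc * C) := by
          rw [norm_inv]
          exact mul_le_mul_of_nonneg_left (hp.trans (mul_le_mul_of_nonneg_right hd hC0))
            (by positivity)
        _ ≤ ‖α‖⁻¹ * (norm2 Dm⁻¹ * penFrob ΔXc ΔYc * C) *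
            (norm2 Dm * penFrob Xh Yh / penFrob (Dm * Xh) (Dm * Yh)) :=
          le_mul_of_one_le_right (by positivity) ((one_le_div hl).2 hL)
        _ = _ := by
          rw [cond2]
          ring
    refine (div_le_div_of_nonneg_right hbound (Real.sqrt_nonneg _)).trans_eq ?_
    rw [famFrob]
    ring
  · intro d ε
    rw [hsum, hXS, hYS]
    exact hasMinIndices_Nr_strictEquiv hS' hT' _ _ ε
  · intro d δ
    rw [hsum, hXS, hYS]
    exact hasMinIndices_Nl_strictEquiv hS' hT' _ _ δ
  · intro d ε
    rw [hX₀, hY₀, ← hA]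
    exact hasMinIndices_Nr_strictEquiv hS₀' hT₀ _ _ ε
  · intro d δ
    rw [hX₀, hY₀, ← hA]
    exact hasMinIndices_Nl_strictEquiv hS₀' hT₀ _ _ δ
end GLin
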